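/- arXiv:math/0204122 — 2 statements merged into one kernel-verified Lean document; each statement's English description precedes it below -/
import Mathlib

section
/- Let X be a tree-like metric continuum expressed as the inverse limit of trees Tₙ with surjective bonding maps, with projections fₙ : X → Tₙ. For each n let Pₙ = ⋃{fₙ⁻¹(q) : q is a branch point of Tₙ}. If the union ⋃ₙ Pₙ is not dense in X, then X contains a non-degenerate chainable subcontinuum. -/
open Metric Set Function

def IsSubcontinuum {X : Type*} [TopologicalSpace X] (A : Set X) : Prop :=
  IsCompact A ∧ IsConnected A

def Chainable (X : Type*) [MetricSpace X] : Prop :=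
  ∀ ε : ℝ, 0 < ε → ∃ n : ℕ, ∃ C : Fin (n + 1) → Set X,
    (∀ i, IsOpen (C i)) ∧ (⋃ i, C i) = Set.univ ∧
    (∀ i, Metric.diam (C i) < ε) ∧
    (∀ i j, (C i ∩ C j).Nonempty ↔ |(i : ℤ) - (j : ℤ)| ≤ 1)

def SetUnicoherent {X : Type*} [TopologicalSpace X] (H : Set X) : Prop :=
  ∀ A B : Set X, IsSubcontinuum A → IsSubcontinuum B → A ∪ B = H → IsConnected (A ∩ B)

def Unicoherent (X : Type*) [TopologicalSpace X] : Prop :=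
  ∀ A B : Set X, IsSubcontinuum A → IsSubcontinuum B → A ∪ B = Set.univ → IsConnected (A ∩ B)

def SetDecomposable {X : Type*} [TopologicalSpace X] (H : Set X) : Prop :=
  ∃ A B : Set X, IsSubcontinuum A ∧ IsSubcontinuum B ∧ A ⊂ H ∧ B ⊂ H ∧ A ∪ B = H

def IsTriod {X : Type*} [TopologicalSpace X] (T : Set X) : Prop :=
  IsSubcontinuum T ∧ ∃ Z : Set X, IsSubcontinuum Z ∧ Z ⊆ T ∧
    ∃ x ∈ T \ Z, ∃ y ∈ T \ Z, ∃ z ∈ T \ Z,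
      connectedComponentIn (T \ Z) x ≠ connectedComponentIn (T \ Z) y ∧
      connectedComponentIn (T \ Z) x ≠ connectedComponentIn (T \ Z) z ∧
      connectedComponentIn (T \ Z) y ≠ connectedComponentIn (T \ Z) z

def AlmostChainable (M : Type*) [MetricSpace M] : Prop :=
  ∀ ε : ℝ, 0 < ε → ∃ (G : Set (Set M)) (n : ℕ) (L : Fin (n + 1) → Set M),
    (∀ U ∈ G, IsOpen U ∧ Metric.diam U < ε) ∧ ⋃₀ G = Set.univ ∧
    (∀ i, L i ∈ G) ∧
    (∀ i j, (L i ∩ L j).Nonempty ↔ |(i : ℤ) - (j : ℤ)| ≤ 1) ∧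
    (∀ i : Fin (n + 1), (i : ℕ) < n → ∀ U ∈ G, U ∉ Set.range L → L i ∩ U = ∅) ∧
    (∀ x : M, ∃ i, ∃ y ∈ L i, dist x y ≤ ε)

def InverseLimit (Y : ℕ → Type*) [∀ n, TopologicalSpace (Y n)]
    (f : ∀ n, Y (n + 1) → Y n) : Set (∀ n, Y n) :=
  {x | ∀ n, f n (x (n + 1)) = x n}

def IsPolyhedron (Y : Type*) [TopologicalSpace Y] : Prop :=
  ∃ (n : ℕ) (S : Finset (Finset (EuclideanSpace ℝ (Fin n)))),
    Nonempty (Y ≃ₜ ↥(⋃ s ∈ S, convexHull ℝ (s : Set (EuclideanSpace ℝ (Fin n)))))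

def IsGraphSet {n : ℕ} (K : Set (EuclideanSpace ℝ (Fin n))) : Prop :=
  (∃ S : Finset (Finset (EuclideanSpace ℝ (Fin n))), (∀ s ∈ S, s.card ≤ 2) ∧
      K = ⋃ s ∈ S, convexHull ℝ (s : Set (EuclideanSpace ℝ (Fin n)))) ∧
  IsConnected K ∧ K.Nontrivial

def IsTreeSet {n : ℕ} (K : Set (EuclideanSpace ℝ (Fin n))) : Prop :=
  IsGraphSet K ∧ ∀ A : Set (EuclideanSpace ℝ (Fin n)), A ⊆ K → ¬ Nonempty (A ≃ₜ Circle)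

def IsBranchPoint (Y : Type*) [TopologicalSpace Y] (x : Y) : Prop :=
  ¬ ∀ V ∈ nhds x, ∃ U ∈ nhds x,
    U ⊆ V ∧ IsOpen U ∧ (frontier U).Finite ∧ (frontier U).ncard ≤ 2

def KJunctioned (X : Type*) [TopologicalSpace X] (k : ℕ) : Prop :=
  ∃ (m : ℕ → ℕ) (G : ∀ n : ℕ, Set (EuclideanSpace ℝ (Fin (m n))))
    (f : ∀ n : ℕ, ↥(G (n + 1)) → ↥(G n)),
    (∀ n, IsGraphSet (G n)) ∧
    (∀ n, {x : ↥(G n) | IsBranchPoint (↥(G n)) x}.Finite ∧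
      {x : ↥(G n) | IsBranchPoint (↥(G n)) x}.ncard ≤ k) ∧
    (∀ n, Continuous (f n) ∧ Function.Surjective (f n)) ∧
    Nonempty (X ≃ₜ ↥(InverseLimit (fun n => ↥(G n)) f))

def TreeLike (X : Type*) [MetricSpace X] : Prop :=
  ∀ ε : ℝ, 0 < ε → ∃ (m : ℕ) (T : Set (EuclideanSpace ℝ (Fin m))), IsTreeSet T ∧
    ∃ f : X → ↥T, Continuous f ∧ Function.Surjective f ∧ ∀ t, Metric.diam (f ⁻¹' {t}) < ε

noncomputable def Span (X : Type*) [MetricSpace X] : ℝ :=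
  sSup {σ : ℝ | 0 ≤ σ ∧ ∃ Z : Set (X × X), IsSubcontinuum Z ∧
    Prod.fst '' Z = Prod.snd '' Z ∧ ∀ p ∈ Z, σ ≤ dist p.1 p.2}


theorem aux_circle {E : Type*} [MetricSpace E] {T : Set E}
    (hno : ∀ A : Set E, A ⊆ T → ¬ Nonempty (A ≃ₜ Circle))
    {a b : ℝ} {γ : ℝ → E} (hc : ContinuousOn γ (Icc a b)) (hm : MapsTo γ (Icc a b) T)
    {η : ℝ} (hη : 0 < η)
    (hl : ∀ s ∈ Icc a b, ∀ t ∈ Icc a b, |s - t| < η → γ s = γ t → s = t) :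
    InjOn γ (Icc a b) := by
  by_contra hni
  set Q : Set (ℝ × ℝ) := {p ∈ Icc a b ×ˢ Icc a b | dist (γ p.1) (γ p.2) ∈ ({0} : Set ℝ)} with hQ
  have hQc : IsClosed Q := by
    refine ContinuousOn.preimage_isClosed_of_isClosed (s := Icc a b ×ˢ Icc a b)
      (f := fun p : ℝ × ℝ => dist (γ p.1) (γ p.2)) ?_ (isClosed_Icc.prod isClosed_Icc) isClosed_singleton
    have e1 : ContinuousOn (fun p : ℝ × ℝ => γ p.1) (Icc a b ×ˢ Icc a b) :=
      hc.comp continuousOn_fst (fun p hp => hp.1)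
    have e2 : ContinuousOn (fun p : ℝ × ℝ => γ p.2) (Icc a b ×ˢ Icc a b) :=
      hc.comp continuousOn_snd (fun p hp => hp.2)
    exact continuous_dist.comp_continuousOn (e1.prodMk e2)
  have hQ2 : IsCompact (Q ∩ {p : ℝ × ℝ | η ≤ p.2 - p.1}) := by
    have h1 : IsCompact Q := (isCompact_Icc.prod isCompact_Icc).of_isClosed_subset hQc (fun p hp => hp.1)
    exact h1.inter_right (isClosed_le continuous_const (continuous_snd.sub continuous_fst))
  have hne : (Q ∩ {p : ℝ × ℝ | η ≤ p.2 - p.1}).Nonempty := by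
    simp only [InjOn] at hni
    push Not at hni
    obtain ⟨s, hs, t, ht, hst, hne⟩ := hni
    have h1 : η ≤ |s - t| := by
      by_contra h; exact hne (hl s hs t ht (not_le.1 h) hst)
    rcases le_total s t with h | h
    · refine ⟨(s, t), ⟨⟨hs, ht⟩, by simp [hst]⟩, ?_⟩
      rw [abs_of_nonpos (by linarith)] at h1
      simp only [mem_ofPred_eq]; linarith
    · refine ⟨(t, s), ⟨⟨ht, hs⟩, by simp [hst]⟩, ?_⟩
      rw [abs_of_nonneg (by linarith)] at h1
      simp only [mem_ofPred_eq]; linarith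
  obtain ⟨⟨s, t⟩, ⟨⟨⟨hs, ht⟩, hst⟩, hd⟩, hmin⟩ := hQ2.exists_isMinOn hne
    (f := fun p : ℝ × ℝ => p.2 - p.1) (by fun_prop)
  simp only [mem_ofPred_eq, mem_singleton_iff, dist_eq_zero] at hst hd hs ht
  have hlt : 0 < t - s := by linarith
  have key : ∀ x ∈ Icc s t, ∀ y ∈ Icc s t, x < y → γ x = γ y → x = s ∧ y = t := by
    intro x hx y hy hxy he
    have hxI : x ∈ Icc a b := ⟨by linarith [hs.1, hx.1], by linarith [ht.2, hx.2]⟩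
    have hyI : y ∈ Icc a b := ⟨by linarith [hs.1, hy.1], by linarith [ht.2, hy.2]⟩
    have h1 : η ≤ y - x := by
      by_contra h
      have := hl x hxI y hyI (by rw [abs_of_neg (by linarith)]; linarith) he
      linarith
    have := hmin (show (x, y) ∈ _ from ⟨⟨⟨hxI, hyI⟩, by simp [he]⟩, h1⟩)
    simp only [mem_ofPred_eq] at this
    constructor <;> linarith [hx.1, hy.2]
  have : Fact (0 < t - s) := ⟨hlt⟩
  have hsub : Icc s t ⊆ Icc a b := Icc_subset_Icc hs.1 ht.2
  have hcont : Continuous (AddCircle.liftIco (t - s) s γ) := by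
    refine AddCircle.liftIco_continuous ?_ ?_
    · rw [add_sub_cancel]; exact hst
    · rw [add_sub_cancel]; exact hc.mono hsub
  have hinj : Injective (AddCircle.liftIco (t - s) s γ) := by
    intro x y hxy
    obtain ⟨x', hx', rfl⟩ := AddCircle.coe_image_Ico_eq (t - s) s ▸ mem_univ x
    obtain ⟨y', hy', rfl⟩ := AddCircle.coe_image_Ico_eq (t - s) s ▸ mem_univ y
    rw [AddCircle.liftIco_coe_apply hx', AddCircle.liftIco_coe_apply hy'] at hxy
    rw [add_sub_cancel] at hx' hy'
    rcases lt_trichotomy x' y' with h | h | h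
    · have := key x' (Ico_subset_Icc_self hx') y' (Ico_subset_Icc_self hy') h hxy
      linarith [hy'.2, this.2]
    · rw [h]
    · have := key y' (Ico_subset_Icc_self hy') x' (Ico_subset_Icc_self hx') h hxy.symm
      linarith [hx'.2, this.2]
  have hemb := (hcont.isClosedEmbedding hinj).isEmbedding
  refine hno (range (AddCircle.liftIco (t - s) s γ)) ?_
    ⟨hemb.toHomeomorph.symm.trans (AddCircle.homeomorphCircle hlt.ne')⟩
  rintro _ ⟨x, rfl⟩
  obtain ⟨x', hx', rfl⟩ := AddCircle.coe_image_Ico_eq (t - s) s ▸ mem_univ x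
  rw [AddCircle.liftIco_coe_apply hx']
  rw [add_sub_cancel] at hx'
  exact hm (hsub (Ico_subset_Icc_self hx'))

theorem aux_inv {E : Type*} [MetricSpace E] {lo hi : ℝ} {β : ℝ → E}
    (hc : ContinuousOn β (Icc lo hi)) (hi' : InjOn β (Icc lo hi)) :
    ContinuousOn (invFunOn β (Icc lo hi)) (β '' Icc lo hi) := by
  have hleft : LeftInvOn (invFunOn β (Icc lo hi)) β (Icc lo hi) := hi'.leftInvOn_invFunOn
  rw [continuousOn_iff_isClosed]
  intro C hC
  refine ⟨β '' (C ∩ Icc lo hi), ?_, ?_⟩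
  · exact ((isCompact_Icc.inter_left hC).image_of_continuousOn (hc.mono inter_subset_right)).isClosed
  · ext x
    constructor
    · rintro ⟨h1, w, hw, rfl⟩
      rw [mem_preimage, hleft hw] at h1
      exact ⟨⟨w, ⟨h1, hw⟩, rfl⟩, w, hw, rfl⟩
    · rintro ⟨⟨w, ⟨h1, hw⟩, rfl⟩, -⟩
      exact ⟨by rw [mem_preimage, hleft hw]; exact h1, w, hw, rfl⟩

def AuxArc {E : Type*} [MetricSpace E] (T : Set E) (a b : ℝ) (γ : ℝ → E) : Prop :=
  a < b ∧ ContinuousOn γ (Icc a b) ∧ InjOn γ (Icc a b) ∧ MapsTo γ (Icc a b) T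

theorem AuxArc.rev {E : Type*} [MetricSpace E] {T : Set E} {a b : ℝ} {γ : ℝ → E}
    (h : AuxArc T a b γ) : AuxArc T (-b) (-a) (fun s => γ (-s)) := by
  obtain ⟨h1, h2, h3, h4⟩ := h
  have hm : MapsTo (fun s : ℝ => -s) (Icc (-b) (-a)) (Icc a b) := fun s hs =>
    ⟨by linarith [hs.2], by linarith [hs.1]⟩
  refine ⟨by linarith, h2.comp continuous_neg.continuousOn hm, ?_, h4.comp hm⟩
  intro x hx y hy hxy
  exact neg_injective (h3 (hm hx) (hm hy) hxy)

theorem aux_rev_image {E : Type*} (a b : ℝ) (γ : ℝ → E) :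
    (fun s => γ (-s)) '' Icc (-b) (-a) = γ '' Icc a b := by
  ext x
  constructor
  · rintro ⟨s, hs, rfl⟩
    exact ⟨-s, ⟨by linarith [hs.2], by linarith [hs.1]⟩, rfl⟩
  · rintro ⟨s, hs, rfl⟩
    exact ⟨-s, ⟨by linarith [hs.2], by linarith [hs.1]⟩, by simp⟩

theorem aux_glue {E : Type*} [MetricSpace E] {T : Set E}
    (hno : ∀ A : Set E, A ⊆ T → ¬ Nonempty (A ≃ₜ Circle))
    {a b : ℝ} {γ : ℝ → E} (hγ : AuxArc T a b γ)
    {lo hi v : ℝ} {β : ℝ → E} (hβ : AuxArc T lo hi β) (hv : v ∈ Ico lo hi)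
    (hbv : γ b = β v) {η : ℝ} (hη : 0 < η)
    (hs : ∀ s ∈ Icc a b, |s - b| < η → ∃ w ∈ Icc lo v, γ s = β w) :
    ∃ a' b' γ', AuxArc T a' b' γ' ∧ γ '' Icc a b ⊆ γ' '' Icc a' b' ∧
      β '' Icc v hi ⊆ γ' '' Icc a' b' := by
  obtain ⟨h1, h2, h3, h4⟩ := hγ
  obtain ⟨k1, k2, k3, k4⟩ := hβ
  obtain ⟨hv1, hv2⟩ := hv
  set δ : ℝ → E := fun s => if s ≤ b then γ s else β (v + s - b) with hδ
  have d1 : ∀ s, s ≤ b → δ s = γ s := fun s h => by simp [hδ, h]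
  have d2 : ∀ s, b ≤ s → δ s = β (v + s - b) := fun s h => by
    rcases h.eq_or_lt with rfl | h
    · simp [hδ, hbv]
    · simp [hδ, not_le.2 h]
  have hm2 : MapsTo (fun s => v + s - b) (Icc b (b + hi - v)) (Icc lo hi) := fun s hs =>
    ⟨by linarith [hs.1], by linarith [hs.2]⟩
  have hun : Icc a (b + hi - v) = Icc a b ∪ Icc b (b + hi - v) :=
    (Icc_union_Icc_eq_Icc h1.le (by linarith)).symm
  have hcont : ContinuousOn δ (Icc a (b + hi - v)) := by
    rw [hun]
    refine ContinuousOn.union_of_isClosed ?_ ?_ isClosed_Icc isClosed_Icc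
    · exact h2.congr (fun s hs => d1 s hs.2)
    · exact (k2.comp (by fun_prop) hm2).congr (fun s hs => d2 s hs.1)
  have hmaps : MapsTo δ (Icc a (b + hi - v)) T := by
    intro s hs
    rcases le_total s b with h | h
    · rw [d1 s h]; exact h4 ⟨hs.1, h⟩
    · rw [d2 s h]; exact k4 (hm2 ⟨h, hs.2⟩)
  have hmix : ∀ s ∈ Icc a (b + hi - v), ∀ t ∈ Icc a (b + hi - v), s ≤ b → b < t →
      |s - t| < η → δ s = δ t → False := by
    intro s hs' t ht hsb htb hst he
    rw [d1 s hsb, d2 t htb.le] at he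
    rw [abs_of_neg (by linarith)] at hst
    obtain ⟨w, hw, hw'⟩ := hs s ⟨hs'.1, hsb⟩ (by rw [abs_of_nonpos (by linarith)]; linarith)
    rw [hw'] at he
    have := k3 ⟨hw.1, by linarith [hw.2]⟩ (hm2 ⟨htb.le, ht.2⟩) he
    simp only at this
    linarith [hw.2]
  have hinj : InjOn δ (Icc a (b + hi - v)) := by
    refine aux_circle hno hcont hmaps hη ?_
    intro s hs' t ht hst he
    rcases le_or_gt s b with h | h <;> rcases le_or_gt t b with h' | h'
    · rw [d1 s h, d1 t h'] at he
      exact h3 ⟨hs'.1, h⟩ ⟨ht.1, h'⟩ he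
    · exact (hmix s hs' t ht h h' hst he).elim
    · exact (hmix t ht s hs' h' h (by rwa [abs_sub_comm]) he.symm).elim
    · rw [d2 s h.le, d2 t h'.le] at he
      have := k3 (hm2 ⟨h.le, hs'.2⟩) (hm2 ⟨h'.le, ht.2⟩) he
      simp only at this
      linarith
  refine ⟨a, b + hi - v, δ, ⟨by linarith, hcont, hinj, hmaps⟩, ?_, ?_⟩
  · rintro _ ⟨s, hs, rfl⟩
    exact ⟨s, ⟨hs.1, by linarith [hs.2]⟩, d1 s hs.2⟩
  · rintro _ ⟨s, hs, rfl⟩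
    refine ⟨b + s - v, ⟨by linarith [hs.1], by linarith [hs.2]⟩, ?_⟩
    rw [d2 _ (by linarith [hs.1])]
    congr 1; ring

theorem aux_extend {E : Type*} [MetricSpace E] {T : Set E}
    (hno : ∀ A : Set E, A ⊆ T → ¬ Nonempty (A ≃ₜ Circle))
    {a b : ℝ} {γ : ℝ → E} (hγ : AuxArc T a b γ)
    {lo hi c : ℝ} {β : ℝ → E} (hβ : AuxArc T lo hi β) (hc : c ∈ Icc lo hi)
    (hcΓ : β c ∈ γ '' Icc a b)
    (hV : ∀ v ∈ Ico c hi, ∃ V : Set E, IsOpen V ∧ β v ∈ V ∧ T ∩ V ⊆ β '' Icc lo hi) :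
    ∃ a' b' γ', AuxArc T a' b' γ' ∧ γ '' Icc a b ⊆ γ' '' Icc a' b' ∧
      β '' Icc c hi ⊆ γ' '' Icc a' b' := by
  by_cases hsub : β '' Icc c hi ⊆ γ '' Icc a b
  · exact ⟨a, b, γ, hγ, subset_rfl, hsub⟩
  have hγ0 := hγ
  have hβ0 := hβ
  obtain ⟨h1, h2, h3, h4⟩ := hγ
  obtain ⟨k1, k2, k3, k4⟩ := hβ
  have hΓc : IsClosed (γ '' Icc a b) := (isCompact_Icc.image_of_continuousOn h2).isClosed
  obtain ⟨v, hv, hvΓ, y, hvy, hy⟩ : ∃ v ∈ Ico c hi, (∀ w ∈ Icc c v, β w ∈ γ '' Icc a b) ∧ ∃ y > v,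
      ∀ w ∈ Ioc v y, ∃ w' ∈ Ioc v w, β w' ∉ γ '' Icc a b := by
    by_contra hcon
    push Not at hcon
    apply hsub
    have hD : IsClosed (Icc c hi ∩ β ⁻¹' (γ '' Icc a b)) :=
      (k2.mono (Icc_subset_Icc_left hc.1)).preimage_isClosed_of_isClosed isClosed_Icc hΓc
    have hall : Icc c hi ⊆ {x | ∀ w ∈ Icc c x, β w ∈ γ '' Icc a b} := by
      refine IsClosed.Icc_subset_of_forall_exists_gt ?_ ?_ ?_
      · refine isClosed_of_closure_subset fun x hx => ?_
        have hxI : x ∈ Icc c hi := closure_minimal inter_subset_right isClosed_Icc hx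
        refine ⟨fun w hw => ?_, hxI⟩
        rcases hw.2.eq_or_lt with rfl | hlt
        · refine (closure_minimal ?_ hD hx).2
          rintro z ⟨hz, hz'⟩
          exact ⟨hz', hz z ⟨hz'.1, le_rfl⟩⟩
        · obtain ⟨z, hz, hz'⟩ := mem_closure_iff.1 hx (Ioi w) isOpen_Ioi hlt
          exact hz'.1 w ⟨hw.1, le_of_lt hz⟩
      · intro w hw
        rw [le_antisymm hw.2 hw.1]; exact hcΓ
      · rintro x ⟨hx, hx'⟩ y hxy
        obtain ⟨w, hw, hw'⟩ := hcon x hx' hx y hxy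
        refine ⟨w, fun r hr => ?_, hw⟩
        rcases le_or_gt r x with h | h
        · exact hx r ⟨hr.1, h⟩
        · exact hw' r ⟨h, hr.2⟩
    rintro _ ⟨x, hx, rfl⟩
    exact hall hx x ⟨hx.1, le_rfl⟩
  have hvlo : v ∈ Ico lo hi := ⟨hc.1.trans hv.1, hv.2⟩
  obtain ⟨t, ht, htv⟩ := hvΓ v ⟨hv.1, le_rfl⟩
  obtain ⟨V, hVo, hvV, hVT⟩ := hV v hv
  set θ := invFunOn β (Icc lo hi) with hθ
  have hleft : LeftInvOn θ β (Icc lo hi) := k3.leftInvOn_invFunOn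
  have hθc : ContinuousOn θ (β '' Icc lo hi) := aux_inv k2 k3
  obtain ⟨η, hη, hηV⟩ : ∃ η > 0, ∀ s ∈ Icc a b, |s - t| < η → γ s ∈ β '' Icc lo hi := by
    have := h2 t ht (hVo.mem_nhds (htv ▸ hvV))
    rw [Filter.mem_map, Metric.mem_nhdsWithin_iff] at this
    obtain ⟨η, hη, h⟩ := this
    exact ⟨η, hη, fun s hs hst => hVT ⟨h4 hs, h ⟨by simpa [Real.dist_eq] using hst, hs⟩⟩⟩
  set τ : ℝ → ℝ := fun s => θ (γ s) with hτ
  have hτβ : ∀ s ∈ Icc a b, |s - t| < η → τ s ∈ Icc lo hi ∧ β (τ s) = γ s := by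
    intro s hs hst
    obtain ⟨w, hw, hw'⟩ := hηV s hs hst
    have : τ s = w := by simp only [hτ, ← hw']; exact hleft hw
    rw [this]; exact ⟨hw, hw'⟩
  have hτt : τ t = v := by simp only [hτ, htv]; exact hleft ⟨hvlo.1, hvlo.2.le⟩
  have hτc : ∀ s s' : ℝ, (∀ r ∈ uIcc s s', r ∈ Icc a b ∧ |r - t| < η) → ContinuousOn τ (uIcc s s') := by
    intro s s' h
    exact hθc.comp (h2.mono fun r hr => (h r hr).1) (fun r hr => hηV r (h r hr).1 (h r hr).2)
  have hseg : ∀ s ∈ Icc a b, |s - t| < η → ∀ r ∈ uIcc s t, r ∈ Icc a b ∧ |r - t| < η := by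
    intro s hs hst r hr
    refine ⟨(ordConnected_Icc.uIcc_subset hs ht) hr, lt_of_le_of_lt ?_ hst⟩
    have := abs_sub_left_of_mem_uIcc (uIcc_comm s t ▸ hr)
    rw [abs_sub_comm s t, abs_sub_comm r t]
    rw [mem_uIcc] at hr
    rcases hr with ⟨h, h'⟩ | ⟨h, h'⟩
    · rw [abs_of_nonneg (by linarith), abs_of_nonneg (by linarith)]; linarith
    · rw [abs_of_nonpos (by linarith), abs_of_nonpos (by linarith)]; linarith
  have hle : ∀ s ∈ Icc a b, |s - t| < η → τ s ≤ v := by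
    intro s hs hst
    by_contra hcon
    push Not at hcon
    have hI := intermediate_value_uIcc (hτc s t (hseg s hs hst))
    obtain ⟨w', hw', hw''⟩ := hy (min y (τ s)) ⟨lt_min hvy hcon, min_le_left _ _⟩
    have hw : w' ∈ uIcc (τ s) (τ t) := by
      rw [hτt, mem_uIcc]
      exact Or.inr ⟨hw'.1.le, hw'.2.trans (min_le_right _ _)⟩
    obtain ⟨r, hr, hr'⟩ := hI hw
    obtain ⟨hr1, hr2⟩ := hseg s hs hst r hr
    apply hw''
    rw [← hr', (hτβ r hr1 hr2).2]
    exact ⟨r, hr1, rfl⟩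
  have hside : ∀ s ∈ Icc a b, |s - t| < η → ∃ w ∈ Icc lo v, γ s = β w := fun s hs hst =>
    ⟨τ s, ⟨(hτβ s hs hst).1.1, hle s hs hst⟩, (hτβ s hs hst).2.symm⟩
  have hfin : (∃ a' b' γ', AuxArc T a' b' γ' ∧ γ '' Icc a b ⊆ γ' '' Icc a' b' ∧
      β '' Icc v hi ⊆ γ' '' Icc a' b') → ∃ a' b' γ', AuxArc T a' b' γ' ∧
      γ '' Icc a b ⊆ γ' '' Icc a' b' ∧ β '' Icc c hi ⊆ γ' '' Icc a' b' := by
    rintro ⟨a', b', γ', q1, q2, q3⟩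
    refine ⟨a', b', γ', q1, q2, ?_⟩
    rintro _ ⟨x, hx, rfl⟩
    rcases le_total x v with h | h
    · exact q2 (hvΓ x ⟨hx.1, h⟩)
    · exact q3 ⟨x, ⟨h, hx.2⟩, rfl⟩
  apply hfin
  rcases ht.2.eq_or_lt with rfl | htb
  · exact aux_glue hno hγ0 hβ0 hvlo htv hη hside
  rcases ht.1.eq_or_lt with rfl | hta
  · have := aux_glue hno hγ0.rev hβ0 hvlo (v := v) (by simpa using htv) hη (by
      intro s hs hst
      refine hside (-s) ⟨by linarith [hs.2], by linarith [hs.1]⟩ ?_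
      rw [← abs_neg]; convert hst using 2; ring)
    rwa [aux_rev_image] at this
  exfalso
  have hinjτ : ∀ s ∈ Icc a b, |s - t| < η → ∀ r ∈ Icc a b, |r - t| < η → τ s = τ r → s = r := by
    intro s hs hst r hr hrt he
    apply h3 hs hr
    rw [← (hτβ s hs hst).2, ← (hτβ r hr hrt).2, he]
  obtain ⟨s1, hs1, hs1'⟩ : ∃ s1, s1 < t ∧ a ≤ s1 ∧ t - η < s1 := by
    obtain ⟨s1, h, h'⟩ := exists_between (max_lt hta (show t - η < t by linarith))
    exact ⟨s1, h', (le_max_left _ _).trans h.le, (le_max_right _ _).trans_lt h⟩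
  obtain ⟨s2, hs2, hs2'⟩ : ∃ s2, t < s2 ∧ s2 ≤ b ∧ s2 < t + η := by
    obtain ⟨s1, h, h'⟩ := exists_between (lt_min htb (show t < t + η by linarith))
    exact ⟨s1, h, h'.le.trans (min_le_left _ _), h'.trans_le (min_le_right _ _)⟩
  have m1 : s1 ∈ Icc a b := ⟨hs1'.1, by linarith⟩
  have m2 : s2 ∈ Icc a b := ⟨by linarith, hs2'.1⟩
  have n1 : |s1 - t| < η := by rw [abs_of_neg (by linarith)]; linarith
  have n2 : |s2 - t| < η := by rw [abs_of_pos (by linarith)]; linarith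
  rcases le_total (τ s1) (τ s2) with h | h
  · obtain ⟨r, hr, hr'⟩ := intermediate_value_uIcc (hτc s1 t (hseg s1 m1 n1))
      (show τ s2 ∈ uIcc (τ s1) (τ t) by rw [hτt, mem_uIcc]; exact Or.inl ⟨h, hle s2 m2 n2⟩)
    obtain ⟨hr1, hr2⟩ := hseg s1 m1 n1 r hr
    have := hinjτ r hr1 hr2 s2 m2 n2 hr'
    rw [uIcc_of_le hs1.le] at hr
    linarith [hr.2]
  · obtain ⟨r, hr, hr'⟩ := intermediate_value_uIcc (hτc s2 t (hseg s2 m2 n2))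
      (show τ s1 ∈ uIcc (τ s2) (τ t) by rw [hτt, mem_uIcc]; exact Or.inl ⟨h, hle s1 m1 n1⟩)
    obtain ⟨hr1, hr2⟩ := hseg s2 m2 n2 r hr
    have := hinjτ r hr1 hr2 s1 m1 n1 hr'
    rw [uIcc_of_ge hs2.le] at hr
    linarith [hr.1]

def AuxChart {E : Type*} [MetricSpace E] (T : Set E) (p : E) (lo hi : ℝ) (β : ℝ → E)
    (V : Set E) : Prop :=
  AuxArc T lo hi β ∧ IsOpen V ∧ p ∈ V ∧ T ∩ V ⊆ β '' Icc lo hi ∧ β '' Ioo lo hi ⊆ V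

theorem aux_add_chart {E : Type*} [MetricSpace E] {T : Set E}
    (hno : ∀ A : Set E, A ⊆ T → ¬ Nonempty (A ≃ₜ Circle))
    {a b : ℝ} {γ : ℝ → E} (hγ : AuxArc T a b γ)
    {p : E} {lo hi : ℝ} {β : ℝ → E} {V : Set E} (hβ : AuxChart T p lo hi β V)
    (hne : (γ '' Icc a b ∩ V).Nonempty) :
    ∃ a' b' γ', AuxArc T a' b' γ' ∧ γ '' Icc a b ⊆ γ' '' Icc a' b' ∧
      β '' Icc lo hi ⊆ γ' '' Icc a' b' := by
  obtain ⟨hβ, hVo, hpV, hVT, hIV⟩ := hβ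
  obtain ⟨x, hxΓ, hxV⟩ := hne
  obtain ⟨c, hc, rfl⟩ := hVT ⟨by obtain ⟨s, hs, rfl⟩ := hxΓ; exact hγ.2.2.2 hs, hxV⟩
  obtain ⟨a1, b1, γ1, q1, q2, q3⟩ := aux_extend hno hγ hβ hc hxΓ (by
    intro v hv
    refine ⟨V, hVo, ?_, hVT⟩
    rcases hv.1.eq_or_lt with rfl | h
    · exact hxV
    · exact hIV ⟨v, ⟨hc.1.trans_lt h, hv.2⟩, rfl⟩)
  obtain ⟨a2, b2, γ2, r1, r2, r3⟩ := aux_extend hno q1 hβ.rev (c := -c)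
    ⟨by linarith [hc.2], by linarith [hc.1]⟩ (by simpa using q2 hxΓ) (by
    intro v hv
    refine ⟨V, hVo, ?_, by rw [aux_rev_image]; exact hVT⟩
    rcases hv.1.eq_or_lt with rfl | h
    · simpa using hxV
    · exact hIV ⟨-v, ⟨by linarith [hv.2], by linarith [hc.2]⟩, rfl⟩)
  rw [aux_rev_image] at r3
  refine ⟨a2, b2, γ2, r1, q2.trans r2, ?_⟩
  rintro _ ⟨s, hs, rfl⟩
  rcases le_total s c with h | h
  · exact r3 ⟨s, ⟨hs.1, h⟩, rfl⟩
  · exact r2 (q3 ⟨s, ⟨h, hs.2⟩, rfl⟩)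

theorem aux_cover {E : Type*} [MetricSpace E] {T : Set E}
    (hno : ∀ A : Set E, A ⊆ T → ¬ Nonempty (A ≃ₜ Circle))
    {L : Set E} (hLT : L ⊆ T) (hLc : IsCompact L) (hLn : IsConnected L)
    (hch : ∀ p ∈ L, ∃ lo hi β V, AuxChart T p lo hi β V) :
    ∃ a b γ, AuxArc T a b γ ∧ L ⊆ γ '' Icc a b := by
  choose! lo hi β V hC using hch
  obtain ⟨t, htL, htc⟩ := hLc.elim_nhds_subcover V
    (fun x hx => (hC x hx).2.1.mem_nhds (hC x hx).2.2.1)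
  classical
  obtain ⟨x0, hx0⟩ := hLn.nonempty
  obtain ⟨p0, hp0, hx0V⟩ := mem_iUnion₂.1 (htc hx0)
  set 𝓕 : Set (Finset E) := {F | F ⊆ t ∧ p0 ∈ F ∧ ∃ a b γ, AuxArc T a b γ ∧
    ∀ p ∈ F, β p '' Icc (lo p) (hi p) ⊆ γ '' Icc a b} with h𝓕
  have hfin : 𝓕.Finite := (t.powerset.finite_toSet).subset
    (fun F hF => by simpa using hF.1)
  have hne : 𝓕.Nonempty := ⟨{p0}, by simpa using hp0, by simp, lo p0, hi p0, β p0,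
    (hC p0 (htL p0 hp0)).1, fun p hp => by rw [Finset.mem_singleton.1 hp]⟩
  obtain ⟨F, hF⟩ := hfin.exists_maximal hne
  obtain ⟨hFt, hp0F, a, b, γ, hγ, hFγ⟩ := hF.prop
  refine ⟨a, b, γ, hγ, ?_⟩
  have hmem : ∀ p ∈ F, ∀ x ∈ L, x ∈ V p → x ∈ γ '' Icc a b := fun p hp x hx hxV =>
    hFγ p hp ((hC p (htL p (hFt hp))).2.2.2.1 ⟨hLT hx, hxV⟩)
  by_cases hall : t ⊆ F
  · intro x hx
    obtain ⟨p, hp, hpV⟩ := mem_iUnion₂.1 (htc hx)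
    exact hmem p (hall hp) x hx hpV
  exfalso
  obtain ⟨p1, hp1, hp1F⟩ := Finset.not_subset.1 hall
  obtain ⟨y, hyL, hy1, hy2⟩ := hLn.isPreconnected (⋃ p ∈ F, V p) (⋃ p ∈ t \ F, V p)
    (isOpen_biUnion fun p hp => (hC p (htL p (hFt hp))).2.1)
    (isOpen_biUnion fun p hp => (hC p (htL p (Finset.mem_sdiff.1 hp).1)).2.1)
    (by
      intro x hx
      obtain ⟨p, hp, hpV⟩ := mem_iUnion₂.1 (htc hx)
      by_cases h : p ∈ F
      · exact Or.inl (mem_iUnion₂.2 ⟨p, h, hpV⟩)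
      · exact Or.inr (mem_iUnion₂.2 ⟨p, Finset.mem_sdiff.2 ⟨hp, h⟩, hpV⟩))
    ⟨x0, hx0, mem_iUnion₂.2 ⟨p0, hp0F, hx0V⟩⟩
    ⟨p1, htL p1 hp1, mem_iUnion₂.2 ⟨p1, Finset.mem_sdiff.2 ⟨hp1, hp1F⟩, (hC p1 (htL p1 hp1)).2.2.1⟩⟩
  obtain ⟨p, hp, hpV⟩ := mem_iUnion₂.1 hy1
  obtain ⟨q, hq, hqV⟩ := mem_iUnion₂.1 hy2
  obtain ⟨hqt, hqF⟩ := Finset.mem_sdiff.1 hq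
  obtain ⟨a', b', γ', r1, r2, r3⟩ := aux_add_chart hno hγ (hC q (htL q hqt))
    ⟨y, hmem p hp y hyL hpV, hqV⟩
  have hins : insert q F ∈ 𝓕 := by
    refine ⟨Finset.insert_subset hqt hFt, Finset.mem_insert_of_mem hp0F, a', b', γ', r1, ?_⟩
    intro z hz
    rcases Finset.mem_insert.1 hz with rfl | hz
    · exact r3
    · exact (hFγ z hz).trans r2
  exact hqF (hF.le_of_ge hins (Finset.subset_insert q F) (Finset.mem_insert_self q F))

def AuxCone {E : Type*} [NormedAddCommGroup E] [NormedSpace ℝ E] (A : Set E) (p : E) : Prop :=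
  ∃ D : Finset E, (∀ u ∈ D, ‖u‖ = 1) ∧ ∃ r : ℝ, 0 < r ∧ ∀ x, ‖x - p‖ ≤ r → x ≠ p →
    (x ∈ A ↔ ∃ u ∈ D, ∃ t : ℝ, 0 ≤ t ∧ x = p + t • u)

theorem AuxCone.union {E : Type*} [NormedAddCommGroup E] [NormedSpace ℝ E] {A B : Set E} {p : E}
    (hA : AuxCone A p) (hB : AuxCone B p) : AuxCone (A ∪ B) p := by
  classical
  obtain ⟨D, hD, r, hr, h⟩ := hA
  obtain ⟨D', hD', r', hr', h'⟩ := hB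
  refine ⟨D ∪ D', ?_, min r r', lt_min hr hr', ?_⟩
  · intro u hu
    rcases Finset.mem_union.1 hu with hu | hu
    · exact hD u hu
    · exact hD' u hu
  · intro x hx hxp
    rw [mem_union, h x (hx.trans (min_le_left _ _)) hxp, h' x (hx.trans (min_le_right _ _)) hxp]
    constructor
    · rintro (⟨u, hu, q⟩ | ⟨u, hu, q⟩)
      · exact ⟨u, Finset.mem_union_left _ hu, q⟩
      · exact ⟨u, Finset.mem_union_right _ hu, q⟩
    · rintro ⟨u, hu, q⟩
      rcases Finset.mem_union.1 hu with hu | hu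
      · exact Or.inl ⟨u, hu, q⟩
      · exact Or.inr ⟨u, hu, q⟩

theorem aux_cone_far {E : Type*} [NormedAddCommGroup E] [NormedSpace ℝ E] {A : Set E} {p : E}
    (hA : IsClosed A) (hp : p ∉ A) : AuxCone A p := by
  obtain ⟨r, hr, h⟩ := Metric.isOpen_iff.1 hA.isOpen_compl p hp
  refine ⟨∅, by simp, r / 2, by linarith, fun x hx _ => ?_⟩
  have : x ∉ A := h (by rw [mem_ball, dist_eq_norm]; linarith)
  simp [this]

theorem aux_cone_seg0 {E : Type*} [NormedAddCommGroup E] [NormedSpace ℝ E] (p q : E) :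
    AuxCone (segment ℝ p q) p := by
  by_cases hpq : q = p
  · subst hpq
    exact ⟨∅, by simp, 1, one_pos, fun x _ hx => by simpa using hx⟩
  have hn : 0 < ‖q - p‖ := norm_pos_iff.2 (sub_ne_zero.2 hpq)
  refine ⟨{‖q - p‖⁻¹ • (q - p)}, ?_, ‖q - p‖, hn, fun x hx _ => ?_⟩
  · intro u hu
    rw [Finset.mem_singleton.1 hu, norm_smul, norm_inv, norm_norm, inv_mul_cancel₀ hn.ne']
  · simp only [Finset.mem_singleton, exists_eq_left]
    rw [segment_eq_image']
    constructor
    · rintro ⟨t, ht, rfl⟩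
      refine ⟨t * ‖q - p‖, mul_nonneg ht.1 hn.le, ?_⟩
      simp only
      rw [smul_smul, mul_assoc, mul_inv_cancel₀ hn.ne', mul_one]
    · rintro ⟨t, ht, rfl⟩
      refine ⟨t * ‖q - p‖⁻¹, ⟨by positivity, ?_⟩, by simp only [smul_smul]⟩
      rw [add_sub_cancel_left, norm_smul, norm_smul, norm_inv, norm_norm, inv_mul_cancel₀ hn.ne',
        mul_one, Real.norm_of_nonneg ht] at hx
      rw [← div_eq_mul_inv]
      exact div_le_one_of_le₀ hx hn.le

theorem aux_cone_seg {E : Type*} [NormedAddCommGroup E] [NormedSpace ℝ E] (a b p : E) :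
    AuxCone (segment ℝ a b) p := by
  by_cases hp : p ∈ segment ℝ a b
  · have : segment ℝ a b = segment ℝ p a ∪ segment ℝ p b := by
      apply Subset.antisymm
      · intro x hx
        rw [segment_eq_image_lineMap] at hx hp
        obtain ⟨t, ht, rfl⟩ := hp
        obtain ⟨s, hs, rfl⟩ := hx
        rcases le_total s t with h | h
        · left
          rw [← affineSegment_eq_segment]
          have : Wbtw ℝ (AffineMap.lineMap a b t) (AffineMap.lineMap a b s)
              (AffineMap.lineMap a b (0 : ℝ)) := by
            refine Wbtw.map ?_ _
            rw [wbtw_comm, Wbtw, affineSegment_eq_segment, segment_eq_Icc ht.1]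
            exact ⟨hs.1, h⟩
          simpa [Wbtw] using this
        · right
          rw [← affineSegment_eq_segment]
          have : Wbtw ℝ (AffineMap.lineMap a b t) (AffineMap.lineMap a b s)
              (AffineMap.lineMap a b (1 : ℝ)) := by
            refine Wbtw.map ?_ _
            rw [Wbtw, affineSegment_eq_segment, segment_eq_Icc ht.2]
            exact ⟨h, hs.2⟩
          simpa [Wbtw] using this
      · exact union_subset ((convex_segment a b).segment_subset hp (left_mem_segment _ _ _))
          ((convex_segment a b).segment_subset hp (right_mem_segment _ _ _))
    rw [this]
    exact (aux_cone_seg0 p a).union (aux_cone_seg0 p b)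
  · refine aux_cone_far ?_ hp
    rw [← convexHull_pair]
    exact ((Set.toFinite {a, b}).isCompact_convexHull ℝ).isClosed

theorem aux_cone_union {E : Type*} [NormedAddCommGroup E] [NormedSpace ℝ E]
    (S : Finset (Finset E)) (hS : ∀ s ∈ S, s.card ≤ 2) (p : E) :
    AuxCone (⋃ s ∈ S, convexHull ℝ (s : Set E)) p := by
  classical
  induction S using Finset.induction_on with
  | empty => simpa using aux_cone_far isClosed_empty (notMem_empty p)
  | insert s S hs ih =>
    rw [Finset.set_biUnion_insert]
    refine AuxCone.union ?_ (ih fun s hs => hS s (Finset.mem_insert_of_mem hs))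
    have := hS s (Finset.mem_insert_self _ _)
    interval_cases h : s.card
    · rw [Finset.card_eq_zero.1 h]
      simpa using aux_cone_far isClosed_empty (notMem_empty p)
    · obtain ⟨a, rfl⟩ := Finset.card_eq_one.1 h
      have := aux_cone_seg a a p
      simpa using this
    · obtain ⟨a, b, -, rfl⟩ := Finset.card_eq_two.1 h
      have := aux_cone_seg a b p
      rw [← convexHull_pair] at this
      simpa using this

theorem aux_frontier {Y : Type*} [TopologicalSpace Y] {C U : Set Y} (hC : IsPreconnected C)
    (hU : IsOpen U) (h1 : (C ∩ U).Nonempty) (h2 : (C \ U).Nonempty) :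
    (C ∩ frontier U).Nonempty := by
  by_contra hcon
  rw [not_nonempty_iff_eq_empty, eq_empty_iff_forall_notMem] at hcon
  have hcl : ∀ x ∈ C, x ∉ U → x ∉ closure U := fun x hx hxU hxc =>
    hcon x ⟨hx, by rw [hU.frontier_eq]; exact ⟨hxc, hxU⟩⟩
  obtain ⟨y, hy⟩ := h2
  obtain ⟨z, -, hz, hz'⟩ := hC U (closure U)ᶜ hU isClosed_closure.isOpen_compl (fun x hx => by
    by_cases h : x ∈ U
    · exact Or.inl h
    · exact Or.inr (hcl x hx h)) h1 ⟨y, hy.1, hcl y hy.1 hy.2⟩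
  exact hz' (subset_closure hz)

theorem aux_ray {E : Type*} [NormedAddCommGroup E] [NormedSpace ℝ E] {p u w : E} {s t : ℝ}
    (hu : ‖u‖ = 1) (hw : ‖w‖ = 1) (hs : 0 ≤ s) (ht : 0 ≤ t) (h : p + s • u = p + t • w) :
    s = t ∧ (0 < s → u = w) := by
  have h' := add_left_cancel h
  have h2 := congrArg norm h'
  rw [norm_smul, norm_smul, hu, hw, mul_one, mul_one, Real.norm_of_nonneg hs,
    Real.norm_of_nonneg ht] at h2
  refine ⟨h2, fun hs0 => ?_⟩
  rw [← h2] at h'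
  exact smul_right_injective _ hs0.ne' h'

theorem aux_chart {E : Type*} [NormedAddCommGroup E] [NormedSpace ℝ E] {T : Set E}
    (hTc : IsConnected T) (hTn : T.Nontrivial) {p : E} (hp : p ∈ T) (hcone : AuxCone T p)
    (hnb : ¬ IsBranchPoint T ⟨p, hp⟩) : ∃ lo hi β V, AuxChart T p lo hi β V := by
  obtain ⟨D, hD, r, hr, hx⟩ := hcone
  have hnorm : ∀ u ∈ D, ∀ t : ℝ, 0 ≤ t → ‖p + t • u - p‖ = t := fun u hu t ht => by
    rw [add_sub_cancel_left, norm_smul, hD u hu, mul_one, Real.norm_of_nonneg ht]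
  have hray : ∀ u ∈ D, ∀ t ∈ Icc 0 r, p + t • u ∈ T := by
    intro u hu t ht
    rcases ht.1.eq_or_lt with rfl | h0
    · simpa using hp
    · refine (hx _ ?_ ?_).2 ⟨u, hu, t, ht.1, rfl⟩
      · rw [hnorm u hu t ht.1]; exact ht.2
      · intro h
        have := hnorm u hu t ht.1
        rw [h, sub_self, norm_zero] at this
        linarith
  have hback : ∀ x ∈ T, x ∈ ball p r → x = p ∨ ∃ u ∈ D, ∃ t ∈ Icc 0 r, x = p + t • u := by
    intro x hxT hxb
    by_cases hxp : x = p
    · exact Or.inl hxp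
    right
    rw [mem_ball, dist_eq_norm] at hxb
    obtain ⟨u, hu, t, ht, rfl⟩ := (hx x hxb.le hxp).1 hxT
    rw [hnorm u hu t ht] at hxb
    exact ⟨u, hu, t, ⟨ht, hxb.le⟩, rfl⟩
  have hcard : D.card ≤ 2 := by
    rw [IsBranchPoint, not_not] at hnb
    obtain ⟨U, hUn, hUV, hUo, hfin, hle⟩ := hnb (Subtype.val ⁻¹' ball p r)
      (continuous_subtype_val.continuousAt.preimage_mem_nhds (ball_mem_nhds p hr))
    have hpU : (⟨p, hp⟩ : T) ∈ U := mem_of_mem_nhds hUn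
    have hex : ∀ u ∈ D, ∃ y : T, y ∈ frontier U ∧ ∃ t : ℝ, 0 < t ∧ (y : E) = p + t • u := by
      intro u hu
      set σ : Icc (0 : ℝ) r → T := fun t => ⟨p + (t : ℝ) • u, hray u hu t t.2⟩ with hσ
      have hσc : Continuous σ := by
        refine Continuous.subtype_mk ?_ _
        fun_prop
      have : PreconnectedSpace (Icc (0 : ℝ) r) := Subtype.preconnectedSpace isPreconnected_Icc
      obtain ⟨_, ⟨t, rfl⟩, ht⟩ := aux_frontier (isPreconnected_range hσc) hUo
        ⟨⟨p, hp⟩, ⟨⟨0, le_rfl, hr.le⟩, by simp [hσ]⟩, hpU⟩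
        ⟨σ ⟨r, hr.le, le_rfl⟩, ⟨_, rfl⟩, fun h => by
          have := hUV h
          rw [mem_preimage, mem_ball, dist_eq_norm] at this
          simp only [hσ] at this
          rw [hnorm u hu r hr.le] at this
          exact lt_irrefl _ this⟩
      refine ⟨σ t, ht, t, ?_, rfl⟩
      rcases t.2.1.eq_or_lt with h0 | h0
      · exfalso
        have : σ t = ⟨p, hp⟩ := by
          apply Subtype.ext
          simp [hσ, ← h0]
        rw [this, hUo.frontier_eq] at ht
        exact ht.2 hpU
      · exact h0
    have : Nonempty T := ⟨⟨p, hp⟩⟩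
    choose! f hf hft using hex
    have := Set.ncard_le_ncard_of_injOn (s := (D : Set E)) (t := frontier U) f
      (fun u hu => hf u hu) (by
        intro u hu w hw huw
        obtain ⟨t, ht, h1⟩ := hft u hu
        obtain ⟨s, hs, h2⟩ := hft w hw
        rw [huw, h2] at h1
        exact ((aux_ray (hD w hw) (hD u hu) hs.le ht.le h1).2 hs).symm) hfin
    rw [Set.ncard_coe_finset] at this
    exact this.trans hle
  have hVo : IsOpen (ball p r) := isOpen_ball
  have hVp : p ∈ ball p r := mem_ball_self hr
  interval_cases hc : D.card
  · exfalso
    rw [Finset.card_eq_zero] at hc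
    subst hc
    have i1 : ConnectedSpace T := Subtype.connectedSpace hTc
    have i2 : Nontrivial T := hTn.coe_sort
    have i3 : (nhdsWithin (⟨p, hp⟩ : T) {⟨p, hp⟩}ᶜ).NeBot := inferInstance
    have hmem : (Subtype.val ⁻¹' ball p r : Set T) ∈ nhds (⟨p, hp⟩ : T) :=
      continuous_subtype_val.continuousAt.preimage_mem_nhds (ball_mem_nhds p hr)
    obtain ⟨y, hy, hy'⟩ := i3.nonempty_of_mem
      (Filter.inter_mem (mem_nhdsWithin_of_mem_nhds hmem) self_mem_nhdsWithin)
    rcases hback y y.2 hy with h | ⟨u, hu, -⟩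
    · exact hy' (Subtype.ext h)
    · simp at hu
  · obtain ⟨u, rfl⟩ := Finset.card_eq_one.1 hc
    have hu : u ∈ ({u} : Finset E) := Finset.mem_singleton_self u
    refine ⟨0, r, fun t => p + t • u, ball p r, ⟨hr, by fun_prop, ?_, hray u hu⟩, hVo, hVp, ?_, ?_⟩
    · intro s hs t ht h
      exact (aux_ray (hD u hu) (hD u hu) hs.1 ht.1 h).1
    · rintro x ⟨hxT, hxb⟩
      rcases hback x hxT hxb with rfl | ⟨w, hw, t, ht, rfl⟩
      · exact ⟨0, ⟨le_rfl, hr.le⟩, by simp⟩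
      · rw [Finset.mem_singleton.1 hw]
        exact ⟨t, ht, rfl⟩
    · rintro _ ⟨t, ht, rfl⟩
      rw [mem_ball, dist_eq_norm]
      simp only
      rw [hnorm u hu t ht.1.le]; exact ht.2
  · classical
    obtain ⟨u, w, huw, rfl⟩ := Finset.card_eq_two.1 hc
    have hu : u ∈ ({u, w} : Finset E) := by simp
    have hw : w ∈ ({u, w} : Finset E) := by simp
    set β : ℝ → E := fun t => p + (max t 0) • u + (max (-t) 0) • w with hβ
    have b1 : ∀ t, 0 ≤ t → β t = p + t • u := fun t ht => by
      simp [hβ, max_eq_left ht, max_eq_right (neg_nonpos.2 ht)]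
    have b2 : ∀ t, t ≤ 0 → β t = p + (-t) • w := fun t ht => by
      simp only [hβ, max_eq_right ht, max_eq_left (neg_nonneg.2 ht), zero_smul, add_zero]
    have hmix : ∀ s t, 0 ≤ s → t ≤ 0 → β s = β t → s = t := by
      intro s t hs ht h
      rw [b1 s hs, b2 t ht] at h
      obtain ⟨q1, q2⟩ := aux_ray (hD u hu) (hD w hw) hs (neg_nonneg.2 ht) h
      rcases hs.eq_or_lt with h0 | h0
      · linarith
      · exact (huw (q2 h0)).elim
    refine ⟨-r, r, β, ball p r, ⟨by linarith, by simp only [hβ]; fun_prop, ?_, ?_⟩, hVo, hVp, ?_, ?_⟩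
    · intro s hs t ht h
      rcases le_total 0 s with h1 | h1 <;> rcases le_total 0 t with h2 | h2
      · rw [b1 s h1, b1 t h2] at h
        exact (aux_ray (hD u hu) (hD u hu) h1 h2 h).1
      · exact hmix s t h1 h2 h
      · exact (hmix t s h2 h1 h.symm).symm
      · rw [b2 s h1, b2 t h2] at h
        have := (aux_ray (hD w hw) (hD w hw) (neg_nonneg.2 h1) (neg_nonneg.2 h2) h).1
        linarith
    · intro t ht
      rcases le_total 0 t with h | h
      · rw [b1 t h]; exact hray u hu t ⟨h, ht.2⟩
      · rw [b2 t h]; exact hray w hw (-t) ⟨by linarith, by linarith [ht.1]⟩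
    · rintro x ⟨hxT, hxb⟩
      rcases hback x hxT hxb with rfl | ⟨z, hz, t, ht, rfl⟩
      · exact ⟨0, ⟨by linarith, hr.le⟩, by rw [b1 0 le_rfl]; simp⟩
      · rw [Finset.mem_insert, Finset.mem_singleton] at hz
        rcases hz with rfl | rfl
        · exact ⟨t, ⟨by linarith [ht.1], ht.2⟩, b1 t ht.1⟩
        · exact ⟨-t, ⟨by linarith [ht.2], by linarith [ht.1]⟩, by
            rw [b2 _ (by linarith [ht.1]), neg_neg]⟩
    · rintro _ ⟨t, ht, rfl⟩
      rw [mem_ball, dist_eq_norm]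
      rcases le_total 0 t with h | h
      · rw [b1 t h, hnorm u hu t h]; exact ht.2
      · rw [b2 t h, hnorm w hw (-t) (by linarith)]; linarith [ht.1]

theorem aux_tree_arc {m : ℕ} {T : Set (EuclideanSpace ℝ (Fin m))} (hT : IsTreeSet T)
    {L : Set (EuclideanSpace ℝ (Fin m))} (hLT : L ⊆ T) (hLc : IsCompact L) (hLn : IsConnected L)
    (hnb : ∀ p (hp : p ∈ T), p ∈ L → ¬ IsBranchPoint T ⟨p, hp⟩) :
    ∃ a b γ, AuxArc T a b γ ∧ L ⊆ γ '' Icc a b := by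
  obtain ⟨⟨⟨S, hS, hTS⟩, hTc, hTn⟩, hno⟩ := hT
  refine aux_cover hno hLT hLc hLn fun p hp => ?_
  refine aux_chart hTc hTn (hLT hp) ?_ (hnb p (hLT hp) hp)
  rw [hTS]
  exact aux_cone_union S hS p

theorem aux_bump {X : Type*} [MetricSpace X] [CompactSpace X] [ConnectedSpace X] [Nontrivial X]
    {V : Set X} (hV : IsOpen V) (hVn : V.Nonempty) :
    ∃ K : Set X, K ⊆ V ∧ IsSubcontinuum K ∧ K.Nontrivial := by
  obtain ⟨x, hx⟩ := hVn
  obtain ⟨y, hyx⟩ := exists_ne x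
  obtain ⟨r0, hr0, hb0⟩ := Metric.isOpen_iff.1 hV x hx
  obtain ⟨r, hr, hrr⟩ := exists_between (lt_min hr0 (dist_pos.2 hyx))
  have hFV : closedBall x r ⊆ V := (closedBall_subset_ball (hrr.trans_le (min_le_left _ _))).trans hb0
  have hyb : y ∉ ball x r := fun h => by
    rw [mem_ball] at h
    exact lt_asymm h (hrr.trans_le (min_le_right _ _))
  have hFc : IsClosed (closedBall x r) := isClosed_closedBall
  by_cases htd : IsTotallyDisconnected (closedBall x r)
  · exfalso
    have i1 : TotallyDisconnectedSpace (closedBall x r) :=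
      totallyDisconnectedSpace_subtype_iff.2 htd
    have i2 : CompactSpace (closedBall x r) := isCompact_iff_compactSpace.1 hFc.isCompact
    obtain ⟨Z, hZ, hxZ, hZb⟩ := compact_exists_isClopen_in_isOpen
      (X := closedBall x r) (x := ⟨x, mem_closedBall_self hr.le⟩) (U := Subtype.val ⁻¹' ball x r)
      (isOpen_ball.preimage continuous_subtype_val) (mem_ball_self hr)
    have hcl : IsClosed (Subtype.val '' Z) := hFc.isClosedEmbedding_subtypeVal.isClosedMap _ hZ.1
    have hop : IsOpen (Subtype.val '' Z) := by
      obtain ⟨O, hO, rfl⟩ := isOpen_induced_iff.1 hZ.2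
      have : Subtype.val '' (Subtype.val ⁻¹' O : Set (closedBall x r)) = O ∩ ball x r := by
        ext z
        constructor
        · rintro ⟨w, hw, rfl⟩
          exact ⟨hw, hZb hw⟩
        · rintro ⟨hz, hz'⟩
          exact ⟨⟨z, ball_subset_closedBall hz'⟩, hz, rfl⟩
      rw [this]
      exact hO.inter isOpen_ball
    have huniv := (show IsClopen _ from ⟨hcl, hop⟩).eq_univ ⟨x, _, hxZ, rfl⟩
    obtain ⟨w, hw, hwy⟩ := huniv ▸ mem_univ y
    exact hyb (hwy ▸ hZb hw)
  · rw [IsTotallyDisconnected] at htd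
    push Not at htd
    obtain ⟨t, htF, htp, htn⟩ := htd
    refine ⟨closure t, (closure_minimal htF hFc).trans hFV, ⟨isClosed_closure.isCompact,
      ?_, htp.closure⟩, ?_⟩
    · exact htn.nonempty.closure
    · exact htn.mono subset_closure

theorem aux_chainable {Y : Type*} [MetricSpace Y] [CompactSpace Y] [ConnectedSpace Y]
    (hφ : ∀ ε : ℝ, 0 < ε → ∃ φ : Y → ℝ, Continuous φ ∧ ∀ x y, φ x = φ y → dist x y < ε) :
    Chainable Y := by
  intro ε hε
  obtain ⟨φ, hc, hd⟩ := hφ (ε / 2) (by linarith)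
  obtain ⟨δ, hδ, hδd⟩ : ∃ δ > 0, ∀ x y, |φ x - φ y| < δ → dist x y < ε / 2 := by
    have hQ : IsCompact {q : Y × Y | ε / 2 ≤ dist q.1 q.2} :=
      (isClosed_le continuous_const continuous_dist).isCompact
    rcases Set.eq_empty_or_nonempty {q : Y × Y | ε / 2 ≤ dist q.1 q.2} with h | h
    · refine ⟨1, one_pos, fun x y _ => ?_⟩
      by_contra hcon
      exact (h ▸ (show (x, y) ∈ {q : Y × Y | ε / 2 ≤ dist q.1 q.2} from not_lt.1 hcon) :
        (x, y) ∈ (∅ : Set (Y × Y)))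
    · obtain ⟨q, hq, hqm⟩ := hQ.exists_isMinOn h (f := fun q : Y × Y => |φ q.1 - φ q.2|)
        (by fun_prop)
      refine ⟨|φ q.1 - φ q.2|, ?_, fun x y hxy => ?_⟩
      · rw [gt_iff_lt, abs_pos, sub_ne_zero]
        intro he
        exact absurd (hd _ _ he) (not_lt.2 hq)
      · by_contra hcon
        exact absurd (hqm (show (x, y) ∈ {q : Y × Y | ε / 2 ≤ dist q.1 q.2} from not_lt.1 hcon))
          (not_le.2 hxy)
  have hdiam : ∀ C : Set Y, (∀ x ∈ C, ∀ y ∈ C, |φ x - φ y| < δ) → Metric.diam C < ε := by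
    intro C hC
    refine lt_of_le_of_lt (Metric.diam_le_of_forall_dist_le (C := ε / 2) (by linarith) ?_)
      (by linarith)
    exact fun x hx y hy => (hδd x y (hC x hx y hy)).le
  obtain ⟨xa, -, hxa⟩ := isCompact_univ.exists_isMinOn (univ_nonempty (α := Y)) hc.continuousOn
  obtain ⟨xb, -, hxb⟩ := isCompact_univ.exists_isMaxOn (univ_nonempty (α := Y)) hc.continuousOn
  have hA : ∀ x, φ xa ≤ φ x := fun x => hxa (mem_univ x)
  have hB : ∀ x, φ x ≤ φ xb := fun x => hxb (mem_univ x)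
  have hsurj : ∀ z ∈ Icc (φ xa) (φ xb), ∃ x, φ x = z := fun z hz =>
    intermediate_value_univ xa xb hc hz
  rcases (hA xb).eq_or_lt with hAB | hAB
  · refine ⟨0, fun _ => univ, fun _ => isOpen_univ, iUnion_const _, fun _ => hdiam _ ?_, ?_⟩
    · intro x _ y _
      rw [le_antisymm (hAB ▸ hB x) (hA x), le_antisymm (hAB ▸ hB y) (hA y)]
      simpa using hδ
    · intro i j
      have : i = j := Fin.ext (by omega)
      subst this
      simp
  set A := φ xa
  set B := φ xb
  obtain ⟨n, hn⟩ := exists_nat_gt (2 * (B - A) / δ)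
  have hn1 : (0 : ℝ) < (n : ℝ) + 1 := by positivity
  set w : ℝ := (B - A) / (n + 1) with hw
  have hwpos : 0 < w := div_pos (by linarith) hn1
  have hwB : (n + 1) * w = B - A := by rw [hw]; field_simp
  have hwδ : 2 * w < δ := by
    rw [div_lt_iff₀ hδ] at hn
    rw [hw, mul_div_assoc', div_lt_iff₀ hn1]
    nlinarith
  have hle : ∀ k : ℕ, k ≤ n + 1 → A + k * w ≤ B := by
    intro k hk
    have : (k : ℝ) ≤ n + 1 := by exact_mod_cast hk
    nlinarith
  refine ⟨n, fun i => φ ⁻¹' Ioo (A + i.val * w - w / 3) (A + (i.val + 1) * w + w / 3),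
    fun i => isOpen_Ioo.preimage hc, ?_, fun i => hdiam _ ?_, ?_⟩
  · rw [eq_univ_iff_forall]
    intro x
    rw [mem_iUnion]
    have h0 : 0 ≤ (φ x - A) / w := div_nonneg (by linarith [hA x]) hwpos.le
    set k := ⌊(φ x - A) / w⌋₊ with hk
    have k1 : (k : ℝ) * w ≤ φ x - A := by
      rw [← le_div_iff₀ hwpos]; exact Nat.floor_le h0
    have k2 : φ x - A < (k + 1) * w := by
      rw [← div_lt_iff₀ hwpos]; exact Nat.lt_floor_add_one _
    by_cases hkn : k ≤ n
    · exact ⟨⟨k, by omega⟩, by constructor <;> simp only <;> nlinarith⟩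
    · have : (n : ℝ) + 1 ≤ k := by exact_mod_cast (not_le.1 hkn)
      refine ⟨⟨n, by omega⟩, ?_⟩
      have hBx := hB x
      constructor <;> simp only <;> nlinarith
  · intro x hx y hy
    rw [mem_preimage, mem_Ioo] at hx hy
    rw [abs_sub_lt_iff]
    constructor <;> nlinarith [hx.1, hx.2, hy.1, hy.2]
  · have hmono : ∀ i j : Fin (n + 1), (i : ℕ) ≤ j →
        (((φ ⁻¹' Ioo (A + i.val * w - w / 3) (A + (i.val + 1) * w + w / 3)) ∩
          (φ ⁻¹' Ioo (A + j.val * w - w / 3) (A + (j.val + 1) * w + w / 3))).Nonempty ↔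
          (j : ℕ) ≤ i + 1) := by
      intro i j hij
      constructor
      · rintro ⟨x, hx, hx'⟩
        rw [mem_preimage, mem_Ioo] at hx hx'
        by_contra hcon
        have : (i.val : ℝ) + 2 ≤ j.val := by
          have : i.val + 2 ≤ j.val := by omega
          exact_mod_cast this
        nlinarith [hx.2, hx'.1]
      · intro hji
        obtain ⟨x, hx⟩ := hsurj (A + (j.val : ℕ) * w) ⟨by
          have : (0 : ℝ) ≤ (j.val : ℝ) * w := by positivity
          linarith, hle _ (by have := j.2; omega)⟩
        have e1 : (i.val : ℝ) ≤ j.val := by exact_mod_cast hij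
        have e2 : (j.val : ℝ) ≤ i.val + 1 := by exact_mod_cast hji
        refine ⟨x, ?_, ?_⟩
        · rw [mem_preimage, mem_Ioo, hx]
          constructor <;> nlinarith
        · rw [mem_preimage, mem_Ioo, hx]
          constructor <;> nlinarith
    intro i j
    rcases le_total (i : ℕ) j with h | h
    · rw [hmono i j h, abs_le]
      omega
    · rw [inter_comm, hmono j i h, abs_le]
      omega

theorem stmt15 (X : Type*) [MetricSpace X] [CompactSpace X] [ConnectedSpace X]
    (htl : TreeLike X)
    (m : ℕ → ℕ) (T : ∀ n : ℕ, Set (EuclideanSpace ℝ (Fin (m n))))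
    (hT : ∀ n, IsTreeSet (T n))
    (g : ∀ n : ℕ, ↥(T (n + 1)) → ↥(T n))
    (hg : ∀ n, Continuous (g n) ∧ Function.Surjective (g n))
    (h : X ≃ₜ ↥(InverseLimit (fun n => ↥(T n)) g))
    (P : ℕ → Set X)
    (hP : ∀ n, P n = {x : X | IsBranchPoint (↥(T n)) ((h x).1 n)})
    (hnd : ¬ Dense (⋃ n, P n)) :
    ∃ K : Set X, IsSubcontinuum K ∧ K.Nontrivial ∧ Chainable ↥K := by
  have hnt : Nontrivial X := by
    obtain ⟨s, hs, t, ht, hst⟩ := (hT 0).1.2.2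
    have hex : ∀ q : T 0, ∃ x : X, (h x).1 0 = q := by
      intro q
      let z : ∀ n, T n := fun n =>
        Nat.rec (motive := fun n => T n) q (fun n y => ((hg n).2 y).choose) n
      have hz : z ∈ InverseLimit (fun n => ↥(T n)) g := fun n => ((hg n).2 (z n)).choose_spec
      exact ⟨h.symm ⟨z, hz⟩, by rw [h.apply_symm_apply]; rfl⟩
    obtain ⟨x, hx⟩ := hex ⟨s, hs⟩
    obtain ⟨y, hy⟩ := hex ⟨t, ht⟩
    refine ⟨x, y, fun hxy => hst ?_⟩
    rw [hxy, hy] at hx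
    exact (congrArg Subtype.val hx).symm
  obtain ⟨K, hKV, hK, hKn⟩ := aux_bump (V := (closure (⋃ n, P n))ᶜ) isClosed_closure.isOpen_compl
    (by rw [nonempty_compl]; exact fun hh => hnd (dense_iff_closure_eq.2 hh))
  refine ⟨K, hK, hKn, ?_⟩
  have iK : CompactSpace K := isCompact_iff_compactSpace.1 hK.1
  have iK2 : ConnectedSpace K := Subtype.connectedSpace hK.2
  have hfc : ∀ n, Continuous (fun x : X => (h x).1 n) := fun n =>
    (continuous_apply n).comp (continuous_subtype_val.comp h.continuous)
  apply aux_chainable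
  intro ε hε
  obtain ⟨n, hn⟩ : ∃ n, ∀ x y : X, (h x).1 n = (h y).1 n → dist x y < ε := by
    by_contra hcon
    push Not at hcon
    set Q : ℕ → Set (X × X) := fun n => {q | (h q.1).1 n = (h q.2).1 n} ∩ {q | ε ≤ dist q.1 q.2}
      with hQ
    have hQc : ∀ n, IsClosed (Q n) := fun n =>
      (isClosed_eq ((hfc n).comp continuous_fst) ((hfc n).comp continuous_snd)).inter
        (isClosed_le continuous_const continuous_dist)
    obtain ⟨q, hq⟩ := IsCompact.nonempty_iInter_of_sequence_nonempty_isCompact_isClosed Q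
      (fun n q hq => ⟨by
        have := congrArg (g n) hq.1
        rwa [(h q.1).2 n, (h q.2).2 n] at this, hq.2⟩)
      (fun n => by
        obtain ⟨x, y, h1, h2⟩ := hcon n
        exact ⟨(x, y), h1, h2⟩) (hQc 0).isCompact hQc
    rw [mem_iInter] at hq
    have : q.1 = q.2 := by
      apply h.injective
      apply Subtype.ext
      funext n
      exact (hq n).1
    have h2 : ε ≤ dist q.1 q.2 := (hq 0).2
    rw [this, dist_self] at h2
    linarith
  set f : X → EuclideanSpace ℝ (Fin (m n)) := fun x => ((h x).1 n : EuclideanSpace ℝ (Fin (m n)))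
    with hf
  have hfcont : Continuous f := continuous_subtype_val.comp (hfc n)
  obtain ⟨a, b, γ, hγ, hL⟩ := aux_tree_arc (hT n) (L := f '' K)
    (by rintro _ ⟨x, -, rfl⟩; exact ((h x).1 n).2) (hK.1.image hfcont)
    (hK.2.image f hfcont.continuousOn) (by
      rintro _ hp ⟨x, hx, rfl⟩ hb
      refine hKV hx (subset_closure (mem_iUnion.2 ⟨n, ?_⟩))
      rw [hP n]
      exact hb)
  have hinv := aux_inv hγ.2.1 hγ.2.2.1
  refine ⟨fun x => invFunOn γ (Icc a b) (f x), ?_, ?_⟩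
  · exact hinv.comp_continuous (hfcont.comp continuous_subtype_val) (fun x => hL ⟨x, x.2, rfl⟩)
  · intro x y hxy
    refine hn x y (Subtype.ext ?_)
    have e1 := invFunOn_eq (hL ⟨x, x.2, rfl⟩ : f x ∈ γ '' Icc a b)
    have e2 := invFunOn_eq (hL ⟨y, y.2, rfl⟩ : f y ∈ γ '' Icc a b)
    simp only at hxy
    rw [hxy, e2] at e1
    exact e1.symm
end

section
/- Let X be the inverse limit of trees Tₙ with surjective bonding maps and projections fₙ : X → Tₙ, and let Pₙ be the union of the fibers fₙ⁻¹(q) over branch points q of Tₙ. If some subsequence {P_{n_k}} has union that is not dense in X, then X contains a non-degenerate chainable subcontinuum. -/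
open Metric Set Function

structure PArc {Y : Type*} [TopologicalSpace Y] (γ : ℝ → Y) (a b : ℝ) : Prop where
  le : a ≤ b
  cont : ContinuousOn γ (Icc a b)
  inj : InjOn γ (Icc a b)

def ArcSet {Y : Type*} [TopologicalSpace Y] (J : Set Y) : Prop :=
  ∃ (γ : ℝ → Y) (a b : ℝ), PArc γ a b ∧ γ '' Icc a b = J

theorem PArc.sub {Y : Type*} [TopologicalSpace Y] {γ : ℝ → Y} {a b c d : ℝ} (h : PArc γ a b)
    (hac : a ≤ c) (hcd : c ≤ d) (hdb : d ≤ b) : PArc γ c d :=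
  ⟨hcd, h.cont.mono (Icc_subset_Icc hac hdb), h.inj.mono (Icc_subset_Icc hac hdb)⟩

theorem PArc.rev {Y : Type*} [TopologicalSpace Y] {γ : ℝ → Y} {a b : ℝ} (h : PArc γ a b) :
    PArc (fun t => γ (-t)) (-b) (-a) := by
  have hm : MapsTo (fun t : ℝ => -t) (Icc (-b) (-a)) (Icc a b) := by
    intro t ht; constructor <;> linarith [ht.1, ht.2]
  refine ⟨by linarith [h.le], h.cont.comp (by fun_prop) hm, ?_⟩
  intro x hx y hy hxy
  have := h.inj (hm hx) (hm hy) hxy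
  simpa using this

theorem rev_image {Y : Type*} (γ : ℝ → Y) (a b : ℝ) :
    (fun t => γ (-t)) '' Icc (-b) (-a) = γ '' Icc a b := by
  ext y; constructor
  · rintro ⟨t, ht, rfl⟩; exact ⟨-t, ⟨by linarith [ht.2], by linarith [ht.1]⟩, rfl⟩
  · rintro ⟨t, ht, rfl⟩
    exact ⟨-t, ⟨by linarith [ht.2], by linarith [ht.1]⟩, by simp⟩

theorem PArc.conn {Y : Type*} [TopologicalSpace Y] {γ : ℝ → Y} {a b : ℝ} (h : PArc γ a b) :
    IsPreconnected (γ '' Icc a b) := isPreconnected_Icc.image _ h.cont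

theorem PArc.compact {Y : Type*} [TopologicalSpace Y] {γ : ℝ → Y} {a b : ℝ} (h : PArc γ a b) :
    IsCompact (γ '' Icc a b) := isCompact_Icc.image_of_continuousOn h.cont

theorem ArcSet.compact {Y : Type*} [TopologicalSpace Y] {J : Set Y} (h : ArcSet J) :
    IsCompact J := by
  obtain ⟨γ, a, b, h, rfl⟩ := h; exact h.compact

theorem arc_concat {Y : Type*} [TopologicalSpace Y] {γ σ : ℝ → Y} {a b u v : ℝ}
    (h : PArc γ a b) (h' : PArc σ u v) (e : γ b = σ u) :
    ∃ δ : ℝ → Y, ContinuousOn δ (Icc a (b + (v - u))) ∧ (∀ t ∈ Icc a b, δ t = γ t) ∧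
      (∀ t ∈ Icc b (b + (v - u)), δ t = σ (t - b + u)) := by
  classical
  have h1 : ∀ t ∈ Icc a b, (fun t => if t ≤ b then γ t else σ (t - b + u)) t = γ t := by
    intro t ht; simp [ht.2]
  have h2 : ∀ t ∈ Icc b (b + (v - u)),
      (fun t => if t ≤ b then γ t else σ (t - b + u)) t = σ (t - b + u) := by
    intro t ht
    rcases eq_or_lt_of_le ht.1 with h0 | h0
    · subst h0; simp [e]
    · simp [not_le.2 h0]
  refine ⟨_, ?_, h1, h2⟩
  rw [← Icc_union_Icc_eq_Icc h.le (by linarith [h'.le] : b ≤ b + (v - u))]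
  refine ContinuousOn.union_of_isClosed ?_ ?_ isClosed_Icc isClosed_Icc
  · exact h.cont.congr h1
  · refine ContinuousOn.congr ?_ h2
    refine h'.cont.comp (by fun_prop) ?_
    intro t ht; constructor <;> linarith [ht.1, ht.2]

theorem arc_glue {Y : Type*} [TopologicalSpace Y] {γ σ : ℝ → Y} {a b u v : ℝ}
    (h : PArc γ a b) (h' : PArc σ u v) (e : γ b = σ u)
    (hd : ∀ t ∈ Ioc u v, σ t ∉ γ '' Icc a b) :
    ArcSet (γ '' Icc a b ∪ σ '' Icc u v) := by
  obtain ⟨δ, hc, h1, h2⟩ := arc_concat h h' e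
  have hab := h.le
  have huv := h'.le
  refine ⟨δ, a, b + (v - u), ⟨by linarith, hc, ?_⟩, ?_⟩
  · have key : ∀ x ∈ Icc a b, ∀ y ∈ Ioc b (b + (v - u)), δ x ≠ δ y := by
      intro x hx y hy hxy
      rw [h1 x hx, h2 y ⟨hy.1.le, hy.2⟩] at hxy
      exact hd (y - b + u) ⟨by linarith [hy.1], by linarith [hy.2]⟩ ⟨x, hx, hxy⟩
    intro x hx y hy hxy
    rcases le_or_gt x b with hxb | hxb <;> rcases le_or_gt y b with hyb | hyb
    · rw [h1 x ⟨hx.1, hxb⟩, h1 y ⟨hy.1, hyb⟩] at hxy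
      exact h.inj ⟨hx.1, hxb⟩ ⟨hy.1, hyb⟩ hxy
    · exact absurd hxy (key x ⟨hx.1, hxb⟩ y ⟨hyb, hy.2⟩)
    · exact absurd hxy.symm (key y ⟨hy.1, hyb⟩ x ⟨hxb, hx.2⟩)
    · rw [h2 x ⟨hxb.le, hx.2⟩, h2 y ⟨hyb.le, hy.2⟩] at hxy
      have := h'.inj (by constructor <;> linarith [hx.2]) (by constructor <;> linarith [hy.2]) hxy
      linarith
  · rw [← Icc_union_Icc_eq_Icc hab (by linarith : b ≤ b + (v - u)), image_union]
    congr 1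
    · exact image_congr h1
    · rw [image_congr h2]
      ext y; constructor
      · rintro ⟨t, ht, rfl⟩
        exact ⟨t - b + u, by constructor <;> linarith [ht.1, ht.2], rfl⟩
      · rintro ⟨t, ht, rfl⟩
        exact ⟨t + b - u, by constructor <;> linarith [ht.1, ht.2], by ring_nf⟩

theorem circle_of_arcs {Y : Type*} [TopologicalSpace Y] {γ σ : ℝ → Y} {a b u v : ℝ}
    (h : PArc γ a b) (h' : PArc σ u v) (hab : a < b) (e : γ b = σ u) (e' : γ a = σ v)
    (hd : ∀ t ∈ Ioo u v, σ t ∉ γ '' Icc a b) :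
    ∃ f : Circle → Y, Continuous f ∧ Function.Injective f := by
  obtain ⟨δ, hc, h1, h2⟩ := arc_concat h h' e
  have huv := h'.le
  have hp : 0 < b + (v - u) - a := by linarith
  have : Fact (0 < b + (v - u) - a) := ⟨hp⟩
  have hap : a + (b + (v - u) - a) = b + (v - u) := by ring
  have hinj : InjOn δ (Ico a (a + (b + (v - u) - a))) := by
    rw [hap]
    have key : ∀ x ∈ Icc a b, ∀ y ∈ Ioo b (b + (v - u)), δ x ≠ δ y := by
      intro x hx y hy hxy
      rw [h1 x hx, h2 y ⟨hy.1.le, hy.2.le⟩] at hxy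
      exact hd (y - b + u) ⟨by linarith [hy.1], by linarith [hy.2]⟩ ⟨x, hx, hxy⟩
    intro x hx y hy hxy
    rcases le_or_gt x b with hxb | hxb <;> rcases le_or_gt y b with hyb | hyb
    · rw [h1 x ⟨hx.1, hxb⟩, h1 y ⟨hy.1, hyb⟩] at hxy
      exact h.inj ⟨hx.1, hxb⟩ ⟨hy.1, hyb⟩ hxy
    · exact absurd hxy (key x ⟨hx.1, hxb⟩ y ⟨hyb, hy.2⟩)
    · exact absurd hxy.symm (key y ⟨hy.1, hyb⟩ x ⟨hxb, hx.2⟩)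
    · rw [h2 x ⟨hxb.le, hx.2.le⟩, h2 y ⟨hyb.le, hy.2.le⟩] at hxy
      have := h'.inj (by constructor <;> linarith [hx.2]) (by constructor <;> linarith [hy.2]) hxy
      linarith
  have hcl : Continuous (AddCircle.liftIco (b + (v - u) - a) a δ) := by
    apply AddCircle.liftIco_continuous
    · rw [hap, h1 a ⟨le_rfl, hab.le⟩, h2 _ ⟨by linarith, le_rfl⟩, e']
      congr 1; ring
    · rwa [hap]
  have hil : Function.Injective (AddCircle.liftIco (b + (v - u) - a) a δ) := by
    intro x y hxy
    obtain ⟨x', hx', rfl⟩ := (AddCircle.coe_image_Ico_eq (b + (v - u) - a) a).symm ▸ mem_univ x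
    obtain ⟨y', hy', rfl⟩ := (AddCircle.coe_image_Ico_eq (b + (v - u) - a) a).symm ▸ mem_univ y
    rw [AddCircle.liftIco_coe_apply hx', AddCircle.liftIco_coe_apply hy'] at hxy
    rw [hinj hx' hy' hxy]
  let e := AddCircle.homeomorphCircle hp.ne'
  exact ⟨_, hcl.comp e.symm.continuous, hil.comp e.symm.injective⟩

theorem branch_of_triod {Y : Type*} [TopologicalSpace Y] [T1Space Y] (c : Y) (L : Fin 3 → Set Y)
    (hL : ∀ i, IsPreconnected (L i)) (hc : ∀ i, c ∈ L i) (hn : ∀ i, ∃ x ∈ L i, x ≠ c)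
    (hd : ∀ i j, i ≠ j → L i ∩ L j ⊆ {c}) : IsBranchPoint Y c := by
  intro H
  choose x hx hxc using hn
  obtain ⟨U, hU, hUV, hUo, hf, hcard⟩ := H (range x)ᶜ
    ((finite_range x).isClosed.isOpen_compl.mem_nhds (by rintro ⟨i, hi⟩; exact hxc i hi))
  have hcU : c ∈ U := mem_of_mem_nhds hU
  have hfr : ∀ i, ∃ y ∈ L i, y ∈ frontier U := by
    intro i
    by_contra hno
    push Not at hno
    have hsub : L i ⊆ U ∪ (closure U)ᶜ := by
      intro y hy
      by_cases h1 : y ∈ U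
      · exact Or.inl h1
      · right; intro h2
        exact hno y hy ⟨h2, by rwa [hUo.interior_eq]⟩
    have hxi : x i ∈ (closure U)ᶜ := by
      rcases hsub (hx i) with h1 | h1
      · exact absurd ⟨i, rfl⟩ (hUV h1)
      · exact h1
    obtain ⟨z, -, hz1, hz2⟩ := hL i U (closure U)ᶜ hUo isClosed_closure.isOpen_compl hsub
      ⟨c, hc i, hcU⟩ ⟨x i, hx i, hxi⟩
    exact hz2 (subset_closure hz1)
  choose y hy hyf using hfr
  have hyc : ∀ i, y i ≠ c := by
    intro i h0
    have := (hyf i).2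
    rw [hUo.interior_eq, h0] at this
    exact this hcU
  have hne : ∀ i j, i ≠ j → y i ≠ y j := by
    intro i j hij h0
    exact hyc i (hd i j hij ⟨hy i, h0 ▸ hy j⟩)
  have : 2 < (frontier U).ncard := by
    rw [Set.two_lt_ncard hf]
    exact ⟨y 0, hyf 0, y 1, hyf 1, y 2, hyf 2, hne _ _ (by decide), hne _ _ (by decide),
      hne _ _ (by decide)⟩
  omega

theorem arc_attach {Y : Type*} [TopologicalSpace Y] [T2Space Y] {J : Set Y} {σ : ℝ → Y} {u v : ℝ}
    (hJ : ArcSet J) (h' : PArc σ u v) (hu : σ u ∈ J) (hd : ∀ t ∈ Ioc u v, σ t ∉ J)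
    (hb : ∀ y ∈ J, ¬ IsBranchPoint Y y) : ArcSet (J ∪ σ '' Icc u v) := by
  obtain ⟨γ, a, b, h, rfl⟩ := hJ
  rcases eq_or_lt_of_le h'.le with huv | huv
  · subst huv
    rw [union_eq_left.2]
    · exact ⟨γ, a, b, h, rfl⟩
    · simpa using hu
  obtain ⟨p, hp, hpu⟩ := id hu
  rcases eq_or_lt_of_le hp.2 with h2 | h2
  · subst h2
    exact arc_glue h h' hpu hd
  rcases eq_or_lt_of_le hp.1 with h1 | h1
  · subst h1
    have := arc_glue h.rev h' (by simpa using hpu) (by rwa [rev_image])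
    rwa [rev_image] at this
  exfalso
  refine hb _ hu (branch_of_triod (σ u) ![γ '' Icc a p, γ '' Icc p b, σ '' Icc u v] ?_ ?_ ?_ ?_)
  · intro i; fin_cases i
    · exact (h.sub le_rfl hp.1 hp.2).conn
    · exact (h.sub hp.1 hp.2 le_rfl).conn
    · exact h'.conn
  · intro i; fin_cases i
    · exact ⟨p, ⟨hp.1, le_rfl⟩, hpu⟩
    · exact ⟨p, ⟨le_rfl, hp.2⟩, hpu⟩
    · exact ⟨u, ⟨le_rfl, h'.le⟩, rfl⟩
  · intro i; fin_cases i
    · refine ⟨γ a, ⟨a, ⟨le_rfl, hp.1⟩, rfl⟩, ?_⟩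
      rw [← hpu]; intro h0
      exact h1.ne (h.inj ⟨le_rfl, h.le⟩ hp h0)
    · refine ⟨γ b, ⟨b, ⟨hp.2, le_rfl⟩, rfl⟩, ?_⟩
      rw [← hpu]; intro h0
      exact h2.ne' (h.inj ⟨h.le, le_rfl⟩ hp h0)
    · refine ⟨σ v, ⟨v, ⟨h'.le, le_rfl⟩, rfl⟩, ?_⟩
      intro h0
      exact huv.ne' (h'.inj ⟨h'.le, le_rfl⟩ ⟨le_rfl, h'.le⟩ h0)
  · have k01 : γ '' Icc a p ∩ γ '' Icc p b ⊆ {σ u} := by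
      rintro y ⟨⟨s, hs, rfl⟩, ⟨t, ht, hst⟩⟩
      have := h.inj ⟨hp.1.trans ht.1, ht.2⟩ ⟨hs.1, hs.2.trans hp.2⟩ hst
      have hsp : s = p := le_antisymm hs.2 (this ▸ ht.1)
      rw [hsp, hpu]; rfl
    have kk : γ '' Icc a b ∩ σ '' Icc u v ⊆ {σ u} := by
      rintro y ⟨hy, ⟨t, ht, rfl⟩⟩
      rcases eq_or_lt_of_le ht.1 with h0 | h0
      · rw [← h0]; rfl
      · exact absurd hy (hd t ⟨h0, ht.2⟩)
    have k02 : γ '' Icc a p ∩ σ '' Icc u v ⊆ {σ u} :=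
      (inter_subset_inter_left _ (image_mono (Icc_subset_Icc le_rfl hp.2))).trans kk
    have k12 : γ '' Icc p b ∩ σ '' Icc u v ⊆ {σ u} :=
      (inter_subset_inter_left _ (image_mono (Icc_subset_Icc hp.1 le_rfl))).trans kk
    intro i j hij
    fin_cases i <;> fin_cases j
    · exact absurd rfl hij
    · exact k01
    · exact k02
    · exact inter_comm _ _ ▸ k01
    · exact absurd rfl hij
    · exact k12
    · exact inter_comm _ _ ▸ k02
    · exact inter_comm _ _ ▸ k12
    · exact absurd rfl hij

theorem arc_union {Y : Type*} [TopologicalSpace Y] [T2Space Y] {J S : Set Y}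
    (hJ : ArcSet J) (hS : ArcSet S) (hn : (J ∩ S).Nonempty)
    (hb : ∀ y ∈ J ∪ S, ¬ IsBranchPoint Y y)
    (hcirc : ∀ f : Circle → Y, Continuous f → ¬ Function.Injective f) : ArcSet (J ∪ S) := by
  obtain ⟨σ, c, d, hσ, rfl⟩ := hS
  have hJc := hJ.compact.isClosed
  set C : Set ℝ := Icc c d ∩ σ ⁻¹' J with hC
  have hCcl : IsClosed C := hσ.cont.preimage_isClosed_of_isClosed isClosed_Icc hJc
  have hCcp : IsCompact C := isCompact_Icc.of_isClosed_subset hCcl inter_subset_left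
  have hCne : C.Nonempty := by
    obtain ⟨y, hy, t, ht, rfl⟩ := hn
    exact ⟨t, ht, hy⟩
  have hconv : OrdConnected C := by
    refine ⟨fun t1 h1 t3 h3 t2 h2 => ?_⟩
    by_contra hno
    have ht2 : t2 ∈ Icc c d := ⟨h1.1.1.trans h2.1, h2.2.trans h3.1.2⟩
    have hL : IsCompact (C ∩ Iic t2) := hCcp.inter_right isClosed_Iic
    have hR : IsCompact (C ∩ Ici t2) := hCcp.inter_right isClosed_Ici
    obtain ⟨u, hu, hu'⟩ := hL.exists_isGreatest ⟨t1, h1, h2.1⟩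
    obtain ⟨v, hv, hv'⟩ := hR.exists_isLeast ⟨t3, h3, h2.2⟩
    have hut : u < t2 := lt_of_le_of_ne hu.2 (fun h0 => hno (h0 ▸ hu.1))
    have htv : t2 < v := lt_of_le_of_ne hv.2 (fun h0 => hno (h0 ▸ hv.1))
    have hgap : ∀ t ∈ Ioo u v, σ t ∉ J := by
      intro t ht htJ
      have htC : t ∈ C := ⟨⟨hu.1.1.1.trans ht.1.le, ht.2.le.trans hv.1.1.2⟩, htJ⟩
      rcases le_total t t2 with h0 | h0
      · exact absurd (hu' ⟨htC, h0⟩) (not_le.2 ht.1)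
      · exact absurd (hv' ⟨htC, h0⟩) (not_le.2 ht.2)
    have hσ' : PArc σ u v := hσ.sub hu.1.1.1 (hut.le.trans htv.le) hv.1.1.2
    obtain ⟨γ, a, b, hγ, rfl⟩ := hJ
    obtain ⟨p, hp, hpu⟩ := hu.1.2
    obtain ⟨q, hq, hqv⟩ := hv.1.2
    have hpq : p ≠ q := by
      rintro rfl
      have := hσ.inj hu.1.1 hv.1.1 (hpu.symm.trans hqv)
      linarith
    rcases lt_or_gt_of_ne hpq with h0 | h0
    · obtain ⟨f, hf, hf'⟩ := circle_of_arcs (hγ.sub hp.1 h0.le hq.2) hσ'.rev h0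
        (by simpa using hqv) (by simpa using hpu) (by
          intro t ht hm
          exact hgap (-t) ⟨by linarith [ht.2], by linarith [ht.1]⟩
            (image_mono (Icc_subset_Icc hp.1 hq.2) hm))
      exact hcirc f hf hf'
    · obtain ⟨f, hf, hf'⟩ := circle_of_arcs (hγ.sub hq.1 h0.le hp.2) hσ' h0
        hpu hqv (by
          intro t ht hm
          exact hgap t ht (image_mono (Icc_subset_Icc hq.1 hp.2) hm))
      exact hcirc f hf hf'
  obtain ⟨c', hc', hc''⟩ := hCcp.exists_isLeast hCne
  obtain ⟨d', hd', hd''⟩ := hCcp.exists_isGreatest hCne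
  have hcd' : c' ≤ d' := hc'' hd'
  have hsub : σ '' Icc c' d' ⊆ J := by
    rintro _ ⟨t, ht, rfl⟩; exact (hconv.out hc' hd' ht).2
  have s1 : ArcSet (J ∪ σ '' Icc c c') := by
    have := arc_attach hJ (hσ.sub le_rfl hc'.1.1 hc'.1.2).rev (by simpa using hc'.2) (by
      intro t ht hm
      have : -t ∈ C := ⟨⟨by linarith [ht.2], by linarith [ht.1, hc'.1.2]⟩, hm⟩
      linarith [hc'' this, ht.1]) (fun y hy => hb y (Or.inl hy))
    rwa [rev_image] at this
  have s2 := arc_attach s1 (hσ.sub hd'.1.1 hd'.1.2 le_rfl) (Or.inl hd'.2) (by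
      rintro t ht (hm | ⟨s, hs, hst⟩)
      · have : t ∈ C := ⟨⟨by linarith [ht.1, hd'.1.1], ht.2⟩, hm⟩
        linarith [hd'' this, ht.1]
      · have := hσ.inj ⟨hs.1, hs.2.trans hc'.1.2⟩ ⟨by linarith [ht.1, hd'.1.1], ht.2⟩ hst
        linarith [hs.2, ht.1]) (by
      rintro y (hy | hy)
      · exact hb y (Or.inl hy)
      · exact hb y (Or.inr (image_mono (Icc_subset_Icc le_rfl hc'.1.2) hy)))
  convert s2 using 1
  rw [← Icc_union_Icc_eq_Icc hc'.1.1 hc'.1.2, ← Icc_union_Icc_eq_Icc hcd' hd'.1.2, image_union,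
    image_union]
  ext y
  have := @hsub y
  simp only [mem_union]
  tauto

theorem arc_of_family {Y : Type*} [TopologicalSpace Y] [T2Space Y] {ι : Type*} [Finite ι]
    (Q : ι → Set Y) (A : Set Y) (hA : IsConnected A) (hQ : ∀ i, ArcSet (Q i))
    (hmeet : ∀ i, (A ∩ Q i).Nonempty) (hcov : A ⊆ ⋃ i, Q i)
    (hb : ∀ i, ∀ y ∈ Q i, ¬ IsBranchPoint Y y)
    (hcirc : ∀ f : Circle → Y, Continuous f → ¬ Function.Injective f) :
    ∃ J, ArcSet J ∧ A ⊆ J := by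
  obtain ⟨x0, hx0⟩ := hA.nonempty
  obtain ⟨i0, hi0⟩ := mem_iUnion.1 (hcov hx0)
  have hfin : {I : Set ι | I.Nonempty ∧ ArcSet (⋃ i ∈ I, Q i)}.Finite := toFinite _
  obtain ⟨I, hI⟩ := hfin.exists_maximal ⟨{i0}, singleton_nonempty _, by simpa using hQ i0⟩
  obtain ⟨⟨⟨i1, hi1⟩, hIarc⟩, hmax⟩ := hI
  refine ⟨_, hIarc, ?_⟩
  by_contra hns
  have hcovr : A ⊆ (⋃ i ∈ I, Q i) ∪ (⋃ i ∈ Iᶜ, Q i) := by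
    intro y hy
    obtain ⟨i, hi⟩ := mem_iUnion.1 (hcov hy)
    by_cases h : i ∈ I
    · exact Or.inl (mem_biUnion h hi)
    · exact Or.inr (mem_biUnion h hi)
  have hR : IsClosed (⋃ i ∈ Iᶜ, Q i) :=
    (toFinite _).isClosed_biUnion (fun i _ => (hQ i).compact.isClosed)
  obtain ⟨y, hy, hyn⟩ := not_subset.1 hns
  obtain ⟨z, hz, hz'⟩ := hmeet i1
  obtain ⟨w, -, hw1, hw2⟩ := isPreconnected_closed_iff.1 hA.isPreconnected _ _
    hIarc.compact.isClosed hR hcovr ⟨z, hz, mem_biUnion hi1 hz'⟩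
    ⟨y, hy, (hcovr hy).resolve_left hyn⟩
  obtain ⟨j, hj, hwj⟩ := mem_iUnion₂.1 hw2
  have hnew : ArcSet ((⋃ i ∈ I, Q i) ∪ Q j) := arc_union hIarc (hQ j) ⟨w, hw1, hwj⟩ (by
    rintro y (hy | hy)
    · obtain ⟨i, hi, hyi⟩ := mem_iUnion₂.1 hy
      exact hb i y hyi
    · exact hb j y hy) hcirc
  have : insert j I ⊆ I := hmax (y := insert j I)
    ⟨insert_nonempty _ _, by rw [biUnion_insert, union_comm]; exact hnew⟩ (subset_insert _ _)
  exact hj (this (mem_insert _ _))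

theorem graph_form {n : ℕ} {K : Set (EuclideanSpace ℝ (Fin n))} (hK : IsGraphSet K) :
    ∃ (ι : Type) (_ : Finite ι) (a b : ι → EuclideanSpace ℝ (Fin n)),
      K = ⋃ i, segment ℝ (a i) (b i) := by
  obtain ⟨⟨S, hS, rfl⟩, -, -⟩ := hK
  have key : ∀ s : {s // s ∈ S ∧ s.Nonempty}, ∃ a b,
      convexHull ℝ (s.1 : Set (EuclideanSpace ℝ (Fin n))) = segment ℝ a b := by
    rintro ⟨s, hs, hne⟩
    have h1 := hS s hs
    have h2 := hne.card_pos
    have h3 : s.card = 1 ∨ s.card = 2 := by omega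
    rcases h3 with h3 | h3
    · obtain ⟨a, rfl⟩ := Finset.card_eq_one.1 h3
      exact ⟨a, a, by simp⟩
    · classical
      obtain ⟨a, b, -, rfl⟩ := Finset.card_eq_two.1 h3
      exact ⟨a, b, by simp [convexHull_pair]⟩
  choose a b hab using key
  have hfin : Finite {s // s ∈ S ∧ s.Nonempty} :=
    (S.finite_toSet.subset (fun s hs => hs.1) : {s | s ∈ S ∧ s.Nonempty}.Finite)
  obtain ⟨N, ⟨e⟩⟩ := Finite.exists_equiv_fin {s // s ∈ S ∧ s.Nonempty}
  refine ⟨Fin N, inferInstance, fun i => a (e.symm i), fun i => b (e.symm i), ?_⟩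
  ext x
  simp only [mem_iUnion, ← hab]
  constructor
  · rintro ⟨s, hs, hx⟩
    have hne : s.Nonempty := by
      by_contra h0
      rw [Finset.not_nonempty_iff_eq_empty] at h0
      subst h0
      simp at hx
    exact ⟨e ⟨s, hs, hne⟩, by simpa using hx⟩
  · rintro ⟨i, hx⟩
    exact ⟨_, (e.symm i).2.1, hx⟩

theorem seg_line {E : Type*} [AddCommGroup E] [Module ℝ E] {a b p q x : E}
    (hp : p ∈ segment ℝ a b) (hq : q ∈ segment ℝ a b) (hx : x ∈ segment ℝ a b) (hpq : q ≠ p) :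
    ∃ τ : ℝ, x = p + τ • (q - p) := by
  rw [segment_eq_image'] at hp hq hx
  obtain ⟨t, -, rfl⟩ := hp
  obtain ⟨s, -, rfl⟩ := hq
  obtain ⟨u, -, rfl⟩ := hx
  have hts : s - t ≠ 0 := by
    intro h0
    apply hpq
    rw [sub_eq_zero.1 h0]
  refine ⟨(u - t) / (s - t), ?_⟩
  have : (a + s • (b - a) - (a + t • (b - a))) = (s - t) • (b - a) := by module
  simp only [this, smul_smul, div_mul_cancel₀ _ hts]
  module

theorem nonbranch_of_line {E : Type*} [NormedAddCommGroup E] [NormedSpace ℝ E] {K : Set E}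
    (p : K) (w : E) (hw : w ≠ 0) (r : ℝ) (hr : 0 < r)
    (hl : ∀ x ∈ K, dist x p.1 < r → ∃ τ : ℝ, x = p.1 + τ • w) : ¬ IsBranchPoint K p := by
  intro hbr
  apply hbr
  intro V hV
  obtain ⟨r1, hr1, hV1⟩ := Metric.mem_nhds_iff.1 hV
  have hρ : 0 < min r r1 / 2 := by positivity
  have hρ1 : min r r1 / 2 < r := by linarith [min_le_left r r1, lt_min hr hr1]
  have hρ2 : min r r1 / 2 < r1 := by linarith [min_le_right r r1, lt_min hr hr1]
  generalize min r r1 / 2 = ρ at hρ hρ1 hρ2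
  have hwn : 0 < ‖w‖ := norm_pos_iff.2 hw
  have hsub : Subtype.val '' (frontier (ball p ρ)) ⊆
      ({p.1 + (ρ / ‖w‖) • w, p.1 + (-(ρ / ‖w‖)) • w} : Set E) := by
    rintro _ ⟨x, hx, rfl⟩
    have hd : dist x p = ρ := frontier_ball_subset_sphere hx
    have hd' : dist x.1 p.1 = ρ := hd
    obtain ⟨τ, hτ⟩ := hl x.1 x.2 (by rw [hd']; exact hρ1)
    rw [hτ, dist_self_add_left, norm_smul, Real.norm_eq_abs] at hd'
    have : |τ| = ρ / ‖w‖ := by field_simp; exact hd'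
    rw [hτ]
    rcases abs_eq (by positivity : 0 ≤ ρ / ‖w‖) |>.1 this with h0 | h0
    · left; rw [h0]
    · right; rw [h0]; rfl
  have hfin : (Subtype.val '' (frontier (ball p ρ))).Finite := (toFinite _).subset hsub
  refine ⟨ball p ρ, ball_mem_nhds p hρ, (ball_subset_ball hρ2.le).trans hV1, isOpen_ball,
    hfin.of_finite_image Subtype.val_injective.injOn, ?_⟩
  rw [← ncard_image_of_injective _ Subtype.val_injective]
  exact (ncard_le_ncard hsub (toFinite _)).trans ((ncard_insert_le _ _).trans (by simp))

theorem branch_finite {E : Type*} [NormedAddCommGroup E] [NormedSpace ℝ E] {K : Set E}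
    {ι : Type*} [Finite ι] (a b : ι → E) (hK : K = ⋃ i, segment ℝ (a i) (b i)) :
    {p : K | IsBranchPoint K p}.Finite := by
  have hVf : (⋃ i, ⋃ j, {x : E | segment ℝ (a i) (b i) ∩ segment ℝ (a j) (b j) = {x}}).Finite := by
    refine finite_iUnion fun i => finite_iUnion fun j => Set.Subsingleton.finite ?_
    intro x hx y hy
    exact singleton_injective (hx.symm.trans hy)
  refine (hVf.preimage Subtype.val_injective.injOn).subset ?_
  intro p hp
  by_contra hno
  simp only [mem_preimage, mem_iUnion, mem_ofPred_eq, not_exists] at hno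
  have hcl : ∀ j, IsClosed (segment ℝ (a j) (b j)) := fun j => by
    rw [← convexHull_pair]
    exact (Set.toFinite _).isClosed_convexHull ℝ
  obtain ⟨i, hi⟩ := mem_iUnion.1 (hK.subset p.2)
  have hq : ∀ j, p.1 ∈ segment ℝ (a j) (b j) →
      ∃ q ∈ segment ℝ (a i) (b i) ∩ segment ℝ (a j) (b j), q ≠ p.1 := by
    intro j hj
    by_contra h0
    push Not at h0
    exact hno i j (eq_singleton_iff_unique_mem.2 ⟨⟨hi, hj⟩, h0⟩)
  obtain ⟨q, ⟨hqi, -⟩, hqp⟩ := hq i hi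
  have hfar : (⋃ j ∈ {j | p.1 ∉ segment ℝ (a j) (b j)}, segment ℝ (a j) (b j))ᶜ ∈ nhds p.1 := by
    refine IsOpen.mem_nhds ?_ ?_
    · exact ((toFinite _).isClosed_biUnion (fun j _ => hcl j)).isOpen_compl
    · simp only [mem_compl_iff, mem_iUnion, not_exists]
      intro j hj; exact hj
  obtain ⟨r, hr, hball⟩ := Metric.mem_nhds_iff.1 hfar
  refine nonbranch_of_line p (q - p.1) (sub_ne_zero.2 hqp) r hr ?_ hp
  intro x hx hxr
  obtain ⟨j, hj⟩ := mem_iUnion.1 (hK.subset hx)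
  have hpj : p.1 ∈ segment ℝ (a j) (b j) := by
    by_contra h0
    exact hball (mem_ball.2 hxr) (mem_biUnion (show j ∈ {j | p.1 ∉ segment ℝ (a j) (b j)} from h0) hj)
  obtain ⟨q', ⟨hq1, hq2⟩, hq3⟩ := hq j hpj
  obtain ⟨τ, hτ⟩ := seg_line hpj hq2 hj hq3
  obtain ⟨τ', hτ'⟩ := seg_line hi hqi hq1 hqp
  refine ⟨τ * τ', ?_⟩
  rw [hτ, hτ', add_sub_cancel_left, smul_smul]

theorem piece_arc {E : Type*} [NormedAddCommGroup E] [NormedSpace ℝ E] {K : Set E}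
    (a b : E) (hK : segment ℝ a b ⊆ K) (x : K) (δ : ℝ)
    (hne : {y : K | y.1 ∈ segment ℝ a b ∧ dist y x ≤ δ}.Nonempty) :
    ArcSet {y : K | y.1 ∈ segment ℝ a b ∧ dist y x ≤ δ} := by
  by_cases hab : a = b
  · subst hab
    obtain ⟨y, hy⟩ := hne
    refine ⟨fun _ => y, 0, 0, ⟨le_rfl, continuousOn_const, ?_⟩, ?_⟩
    · intro s hs t ht _
      simp at hs ht; rw [hs, ht]
    · ext z
      simp only [Icc_self, image_singleton, mem_singleton_iff]
      constructor
      · rintro rfl; exact hy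
      · rintro hz
        have h1 := hz.1
        have h2 := hy.1
        rw [segment_same] at h1 h2
        exact Subtype.ext (h1.trans h2.symm)
  let γ : ℝ → K := fun t => ⟨AffineMap.lineMap a b (projIcc (0 : ℝ) 1 zero_le_one t : ℝ), hK (by
    rw [segment_eq_image_lineMap]
    exact ⟨_, (projIcc (0 : ℝ) 1 zero_le_one t).2, rfl⟩)⟩
  have hγc : Continuous γ := by
    refine Continuous.subtype_mk ?_ _
    exact AffineMap.lineMap_continuous.comp (continuous_subtype_val.comp continuous_projIcc)
  have hγ : ∀ t ∈ Icc (0 : ℝ) 1, (γ t).1 = AffineMap.lineMap a b t := by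
    intro t ht
    simp only [γ, projIcc_of_mem zero_le_one ht]
  set P : Set ℝ := Icc 0 1 ∩ (AffineMap.lineMap a b : ℝ →ᵃ[ℝ] E) ⁻¹' closedBall x.1 δ with hP
  have hPconv : Convex ℝ P := (convex_Icc 0 1).inter ((convex_closedBall x.1 δ).affine_preimage _)
  have hPc : IsCompact P := isCompact_Icc.inter_right
    (isClosed_closedBall.preimage AffineMap.lineMap_continuous)
  have him : γ '' P = {y : K | y.1 ∈ segment ℝ a b ∧ dist y x ≤ δ} := by
    ext y; constructor
    · rintro ⟨t, ht, rfl⟩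
      refine ⟨?_, ?_⟩
      · rw [hγ t ht.1, segment_eq_image_lineMap]; exact ⟨t, ht.1, rfl⟩
      · change dist (γ t).1 x.1 ≤ δ
        rw [hγ t ht.1]; exact ht.2
    · rintro ⟨hy, hd⟩
      rw [segment_eq_image_lineMap] at hy
      obtain ⟨t, ht, hty⟩ := hy
      refine ⟨t, ⟨ht, ?_⟩, Subtype.ext ((hγ t ht).trans hty)⟩
      change dist (AffineMap.lineMap a b t) x.1 ≤ δ
      rw [hty]; exact hd
  have hPne : P.Nonempty := by
    rw [← him] at hne; exact hne.of_image
  have hPI := eq_Icc_of_connected_compact ⟨hPne, hPconv.isPreconnected⟩ hPc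
  rw [← him]
  refine ⟨γ, sInf P, sSup P, ⟨?_, hγc.continuousOn, ?_⟩, by rw [← hPI]⟩
  · rw [hPI] at hPne; exact nonempty_Icc.1 hPne
  · rw [← hPI]
    intro s hs t ht hst
    have := congrArg Subtype.val hst
    rw [hγ s hs.1, hγ t ht.1] at this
    exact AffineMap.lineMap_injective ℝ hab this

theorem tree_arc {n : ℕ} {K : Set (EuclideanSpace ℝ (Fin n))} (hK : IsTreeSet K)
    (A : Set K) (hA : IsSubcontinuum A) (hb : ∀ y ∈ A, ¬ IsBranchPoint K y) :
    ∃ J : Set K, ArcSet J ∧ A ⊆ J := by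
  obtain ⟨ι, hι, a, b, hab⟩ := graph_form hK.1
  have hF := branch_finite a b hab
  obtain ⟨δ, hδ, hδF⟩ := hA.1.exists_cthickening_subset_open hF.isClosed.isOpen_compl
    (fun y hy => hb y hy)
  obtain ⟨t, htA, htf, htc⟩ := hA.1.finite_cover_balls hδ
  have : Finite t := htf
  have hcirc : ∀ f : Circle → K, Continuous f → ¬ Function.Injective f := by
    intro f hf hi
    have hc : Continuous (fun z => (f z).1) := continuous_subtype_val.comp hf
    have hi' : Function.Injective (fun z => (f z).1) := Subtype.val_injective.comp hi
    refine hK.2 (range (fun z => (f z).1)) ?_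
      ⟨(hc.isClosedEmbedding hi').isEmbedding.toHomeomorph.symm⟩
    rintro _ ⟨z, rfl⟩; exact (f z).2
  let Q : ι × t → Set K := fun ix => {y : K | y.1 ∈ segment ℝ (a ix.1) (b ix.1) ∧ dist y ix.2.1 ≤ δ}
  refine arc_of_family (fun k : {ix : ι × t // (A ∩ Q ix).Nonempty} => Q k.1) A hA.2 ?_ ?_ ?_ ?_ hcirc
  · intro k
    refine piece_arc _ _ ?_ _ _ (k.2.mono inter_subset_right)
    exact (subset_iUnion (fun i => segment ℝ (a i) (b i)) k.1.1).trans hab.symm.subset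
  · intro k; exact k.2
  · intro y hy
    obtain ⟨x, hx, hyx⟩ := mem_iUnion₂.1 (htc hy)
    obtain ⟨i, hi⟩ := mem_iUnion.1 (hab.subset y.2)
    have hyQ : y ∈ Q (i, ⟨x, hx⟩) := ⟨hi, (mem_ball.1 hyx).le⟩
    exact mem_iUnion.2 ⟨⟨(i, ⟨x, hx⟩), ⟨y, hy, hyQ⟩⟩, hyQ⟩
  · intro k y hy hbr
    exact hδF (mem_cthickening_of_dist_le y k.1.2.1 δ A (htA k.1.2.2) hy.2) hbr

theorem arc_lift {Z Y : Type*} [TopologicalSpace Z] [TopologicalSpace Y] [T2Space Y] {J : Set Y}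
    (hJ : ArcSet J) (f : Z → Y) (hf : Continuous f) (hfJ : ∀ z, f z ∈ J) :
    ∃ ψ : Z → ℝ, Continuous ψ ∧ ∀ x y, ψ x = ψ y → f x = f y := by
  obtain ⟨γ, a, b, h, rfl⟩ := hJ
  choose ψ hψ hψ' using hfJ
  have hemb : Topology.IsClosedEmbedding ((Icc a b).domRestrict γ) :=
    (continuousOn_iff_continuous_domRestrict.1 h.cont).isClosedEmbedding
      (injOn_iff_injective.1 h.inj)
  have hc : Continuous (fun z => (⟨ψ z, hψ z⟩ : Icc a b)) := by
    rw [hemb.isEmbedding.continuous_iff]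
    convert hf using 1
    ext z; exact hψ' z
  refine ⟨ψ, continuous_subtype_val.comp hc, ?_⟩
  intro x y hxy
  rw [← hψ' x, ← hψ' y, hxy]

theorem chain_of_map {Z : Type*} [MetricSpace Z] [CompactSpace Z] [ConnectedSpace Z]
    (ε : ℝ) (hε : 0 < ε) (ψ : Z → ℝ) (hψ : Continuous ψ)
    (hs : ∀ x y, ψ x = ψ y → dist x y < ε / 2) :
    ∃ n : ℕ, ∃ C : Fin (n + 1) → Set Z,
    (∀ i, IsOpen (C i)) ∧ (⋃ i, C i) = Set.univ ∧
    (∀ i, Metric.diam (C i) < ε) ∧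
    (∀ i j, (C i ∩ C j).Nonempty ↔ |(i : ℤ) - (j : ℤ)| ≤ 1) := by
  have hδ : ∃ δ > 0, ∀ x y, |ψ x - ψ y| < δ → dist x y < ε / 2 := by
    have hcp : IsCompact {q : Z × Z | ε / 2 ≤ dist q.1 q.2} :=
      (isClosed_le continuous_const continuous_dist).isCompact
    rcases eq_empty_or_nonempty {q : Z × Z | ε / 2 ≤ dist q.1 q.2} with h0 | h0
    · refine ⟨1, one_pos, fun x y _ => ?_⟩
      by_contra hno
      have : (x, y) ∈ {q : Z × Z | ε / 2 ≤ dist q.1 q.2} := not_lt.1 hno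
      rw [h0] at this; exact this
    · obtain ⟨q, hq, hmin⟩ := hcp.exists_isMinOn h0
        (f := fun q : Z × Z => |ψ q.1 - ψ q.2|) (by fun_prop)
      refine ⟨|ψ q.1 - ψ q.2|, ?_, ?_⟩
      · rw [gt_iff_lt, abs_pos, sub_ne_zero]
        intro he
        exact absurd (hs _ _ he) (not_lt.2 hq)
      · intro x y hxy
        by_contra hno
        exact absurd (hmin (show (x, y) ∈ {q : Z × Z | ε / 2 ≤ dist q.1 q.2} from not_lt.1 hno))
          (not_le.2 hxy)
  obtain ⟨δ, hδ0, hδ⟩ := hδ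
  obtain ⟨xa, -, hxa⟩ := isCompact_univ.exists_isMinOn (univ_nonempty (α := Z)) hψ.continuousOn
  obtain ⟨xb, -, hxb⟩ := isCompact_univ.exists_isMaxOn (univ_nonempty (α := Z)) hψ.continuousOn
  have ha : ∀ x, ψ xa ≤ ψ x := fun x => hxa (mem_univ x)
  have hb : ∀ x, ψ x ≤ ψ xb := fun x => hxb (mem_univ x)
  have hiv : ∀ t, ψ xa ≤ t → t ≤ ψ xb → ∃ x, ψ x = t := by
    intro t h1 h2
    exact mem_range_of_exists_le_of_exists_ge hψ ⟨xa, h1⟩ ⟨xb, h2⟩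
  obtain ⟨d, hd⟩ : ∃ d, d = δ / 2 := ⟨_, rfl⟩
  have hd0 : 0 < d := by rw [hd]; positivity
  have hfl : ∀ x, 0 ≤ (ψ x - ψ xa) / d := fun x => div_nonneg (by linarith [ha x]) hd0.le
  have hn : (⌊(ψ xb - ψ xa) / d⌋₊ : ℝ) * d ≤ ψ xb - ψ xa := by
    have := Nat.floor_le (hfl xb)
    rwa [le_div_iff₀ hd0] at this
  refine ⟨⌊(ψ xb - ψ xa) / d⌋₊, fun i => {x | |ψ x - (ψ xa + (i : ℕ) * d)| < d}, ?_, ?_, ?_, ?_⟩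
  · intro i
    exact isOpen_lt (by fun_prop) continuous_const
  · rw [eq_univ_iff_forall]
    intro x
    refine mem_iUnion.2 ⟨⟨⌊(ψ x - ψ xa) / d⌋₊, ?_⟩, ?_⟩
    · refine Nat.lt_succ_of_le (Nat.floor_le_floor ?_)
      have := hb x
      gcongr
    · have h1 := Nat.floor_le (hfl x)
      have h2 := Nat.lt_floor_add_one ((ψ x - ψ xa) / d)
      rw [le_div_iff₀ hd0] at h1
      rw [div_lt_iff₀ hd0] at h2
      change |ψ x - (ψ xa + (⌊(ψ x - ψ xa) / d⌋₊ : ℝ) * d)| < d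
      rw [abs_lt]; constructor <;> nlinarith
  · intro i
    refine lt_of_le_of_lt (Metric.diam_le_of_forall_dist_le (by positivity : 0 ≤ ε / 2) ?_)
      (by linarith)
    intro x hx y hy
    refine (hδ x y ?_).le
    simp only [mem_ofPred_eq, abs_lt] at hx hy ⊢
    constructor <;> linarith [hx.1, hx.2, hy.1, hy.2]
  · have hpt : ∀ i : Fin (⌊(ψ xb - ψ xa) / d⌋₊ + 1), ((i : ℕ) : ℝ) * d ≤ ψ xb - ψ xa := by
      intro i
      refine le_trans ?_ hn
      have : ((i : ℕ) : ℝ) ≤ (⌊(ψ xb - ψ xa) / d⌋₊ : ℝ) := by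
        exact_mod_cast Nat.le_of_lt_succ i.2
      gcongr
    intro i j
    constructor
    · rintro ⟨x, hx, hy⟩
      simp only [mem_ofPred_eq, abs_lt] at hx hy
      have h1 : ((i : ℕ) : ℝ) < (j : ℕ) + 2 := by
        by_contra h0
        push Not at h0
        nlinarith [hx.1, hy.2]
      have h2 : ((j : ℕ) : ℝ) < (i : ℕ) + 2 := by
        by_contra h0
        push Not at h0
        nlinarith [hy.1, hx.2]
      have h1' : (i : ℕ) < (j : ℕ) + 2 := by exact_mod_cast h1
      have h2' : (j : ℕ) < (i : ℕ) + 2 := by exact_mod_cast h2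
      rw [abs_le]; constructor <;> omega
    · intro hij
      have hij' : |((i : ℕ) : ℝ) - (j : ℕ)| ≤ 1 := by exact_mod_cast hij
      rw [abs_le] at hij'
      obtain ⟨x, hx⟩ := hiv (ψ xa + (((i : ℕ) : ℝ) * d + (j : ℕ) * d) / 2)
        (by
          have : (0 : ℝ) ≤ ((i : ℕ) : ℝ) * d := by positivity
          have : (0 : ℝ) ≤ ((j : ℕ) : ℝ) * d := by positivity
          linarith)
        (by linarith [hpt i, hpt j])
      refine ⟨x, ?_, ?_⟩
      · simp only [mem_ofPred_eq, hx, abs_lt]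
        constructor <;> nlinarith
      · simp only [mem_ofPred_eq, hx, abs_lt]
        constructor <;> nlinarith

theorem bump {X : Type*} [MetricSpace X] [CompactSpace X] [ConnectedSpace X] (x y : X) (r : ℝ)
    (hr : 0 < r) (hy : r < dist y x) : (connectedComponentIn (closedBall x r) x).Nontrivial := by
  by_contra hno
  rw [not_nontrivial_iff] at hno
  have hxB : x ∈ closedBall x r := mem_closedBall_self hr.le
  have : CompactSpace (closedBall x r) := isCompact_iff_compactSpace.1 isClosed_closedBall.isCompact
  set x' : closedBall x r := ⟨x, hxB⟩ with hx'
  have hsing : connectedComponent x' ⊆ {x'} := by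
    intro z hz
    have h1 : z.1 ∈ connectedComponentIn (closedBall x r) x := by
      rw [connectedComponentIn_eq_image hxB]; exact ⟨z, hz, rfl⟩
    exact Subtype.ext (hno h1 (mem_connectedComponentIn hxB))
  rw [connectedComponent_eq_iInter_isClopen] at hsing
  have : Nonempty {s : Set (closedBall x r) // IsClopen s ∧ x' ∈ s} :=
    ⟨⟨univ, isClopen_univ, mem_univ _⟩⟩
  obtain ⟨⟨Z, hZc, hxZ⟩, hZO⟩ := exists_subset_nhds_of_isCompact'
    (V := fun s : {s : Set (closedBall x r) // IsClopen s ∧ x' ∈ s} => s.1)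
    (by
      rintro ⟨s, hs, hxs⟩ ⟨t, ht, hxt⟩
      exact ⟨⟨s ∩ t, hs.inter ht, hxs, hxt⟩, inter_subset_left, inter_subset_right⟩)
    (fun s => s.2.1.1.isCompact) (fun s => s.2.1.1) (U := {z | dist z.1 x < r}) (by
      intro z hz
      have : z = x' := hsing hz
      subst this
      refine IsOpen.mem_nhds (isOpen_lt (by fun_prop) continuous_const) ?_
      change dist x x < r
      rwa [dist_self])
  have hZO : Z ⊆ {z | dist z.1 x < r} := hZO
  have hW : IsClopen (Subtype.val '' Z) := by
    refine ⟨(hZc.1.isCompact.image continuous_subtype_val).isClosed, ?_⟩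
    obtain ⟨G, hG, hGZ⟩ := isOpen_induced_iff.1 hZc.2
    have : Subtype.val '' Z = G ∩ ball x r := by
      ext z; constructor
      · rintro ⟨z, hz, rfl⟩
        refine ⟨?_, hZO hz⟩
        rw [← hGZ] at hz; exact hz
      · rintro ⟨h1, h2⟩
        refine ⟨⟨z, ball_subset_closedBall h2⟩, ?_, rfl⟩
        rw [← hGZ]; exact h1
    rw [this]; exact hG.inter isOpen_ball
  have huniv := hW.eq_univ ⟨x, x', hxZ, rfl⟩
  obtain ⟨z, hz, hzy⟩ := (huniv ▸ mem_univ y : y ∈ Subtype.val '' Z)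
  have := hZO hz
  simp only [mem_ofPred_eq, hzy] at this
  linarith

theorem small_fibers {X : Type*} [MetricSpace X] [CompactSpace X] {Y : ℕ → Type*}
    [∀ n, TopologicalSpace (Y n)] [∀ n, T2Space (Y n)] (π : ∀ n, X → Y n)
    (hπ : ∀ n, Continuous (π n)) (hstep : ∀ n x y, π (n + 1) x = π (n + 1) y → π n x = π n y)
    (hinj : ∀ x y, (∀ n, π n x = π n y) → x = y) (ε : ℝ) (hε : 0 < ε) :
    ∃ N, ∀ n ≥ N, ∀ x y, π n x = π n y → dist x y < ε := by
  have hanti : ∀ n m, n ≤ m → ∀ x y, π m x = π m y → π n x = π n y := by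
    intro n m hnm
    induction hnm with
    | refl => intro x y h; exact h
    | step _ ih => intro x y h; exact ih x y (hstep _ x y h)
  by_contra hno
  push Not at hno
  let D : ℕ → Set (X × X) := fun n => {q | π n q.1 = π n q.2} ∩ {q | ε ≤ dist q.1 q.2}
  have hDc : ∀ n, IsClosed (D n) := fun n =>
    (isClosed_eq ((hπ n).comp continuous_fst) ((hπ n).comp continuous_snd)).inter
      (isClosed_le continuous_const continuous_dist)
  have hmono : ∀ n m, n ≤ m → D m ⊆ D n := fun n m hnm q hq => ⟨hanti n m hnm _ _ hq.1, hq.2⟩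
  obtain ⟨q, hq⟩ := IsCompact.nonempty_iInter_of_directed_nonempty_isCompact_isClosed D
    (fun n m => ⟨max n m, hmono _ _ (le_max_left _ _), hmono _ _ (le_max_right _ _)⟩)
    (fun N => by
      obtain ⟨n, hn, x, y, h1, h2⟩ := hno N
      exact ⟨(x, y), hmono N n hn ⟨h1, h2⟩⟩)
    (fun n => (hDc n).isCompact) hDc
  rw [mem_iInter] at hq
  have h1 := hinj q.1 q.2 (fun n => (hq n).1)
  have h2 : ε ≤ dist q.1 q.2 := (hq 0).2
  rw [h1, dist_self] at h2
  linarith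

theorem stmt16 (X : Type*) [MetricSpace X] [CompactSpace X] [ConnectedSpace X]
    (m : ℕ → ℕ) (T : ∀ n : ℕ, Set (EuclideanSpace ℝ (Fin (m n))))
    (hT : ∀ n, IsTreeSet (T n))
    (g : ∀ n : ℕ, ↥(T (n + 1)) → ↥(T n))
    (hg : ∀ n, Continuous (g n) ∧ Function.Surjective (g n))
    (h : X ≃ₜ ↥(InverseLimit (fun n => ↥(T n)) g))
    (P : ℕ → Set X)
    (hP : ∀ n, P n = {x : X | IsBranchPoint (↥(T n)) ((h x).1 n)})
    (φ : ℕ → ℕ) (hφ : StrictMono φ)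
    (hnd : ¬ Dense (⋃ k, P (φ k))) :
    ∃ K : Set X, IsSubcontinuum K ∧ K.Nontrivial ∧ Chainable ↥K := by
  let π : ∀ n, X → ↥(T n) := fun n x => (h x).1 n
  have hπ : ∀ n, Continuous (π n) := fun n =>
    (continuous_apply n).comp (continuous_subtype_val.comp h.continuous)
  have hstep : ∀ n x, g n (π (n + 1) x) = π n x := fun n x => (h x).2 n
  have hinj : ∀ x y, (∀ n, π n x = π n y) → x = y := by
    intro x y hxy
    exact h.injective (Subtype.ext (funext hxy))
  have hsurj : ∀ t : ↥(T 0), ∃ x, π 0 x = t := by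
    intro t
    choose s hs using fun n => (hg n).2
    let p : ∀ n, ↥(T n) := fun n => Nat.rec t (fun k y => s k y) n
    have hp : p ∈ InverseLimit (fun n => ↥(T n)) g := fun n => hs n (p n)
    refine ⟨h.symm ⟨p, hp⟩, ?_⟩
    simp only [π, Homeomorph.apply_symm_apply]
    rfl
  obtain ⟨t1, ht1, t2, ht2, ht⟩ := (hT 0).1.2.2
  obtain ⟨x1, hx1⟩ := hsurj ⟨t1, ht1⟩
  obtain ⟨x2, hx2⟩ := hsurj ⟨t2, ht2⟩
  have hx12 : x1 ≠ x2 := by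
    rintro rfl
    exact ht (congrArg Subtype.val (hx1.symm.trans hx2))
  have : Nontrivial X := ⟨x1, x2, hx12⟩
  unfold Dense at hnd
  push Not at hnd
  obtain ⟨x, hx⟩ := hnd
  obtain ⟨r1, hr1, hball⟩ := Metric.mem_nhds_iff.1 (isClosed_closure.isOpen_compl.mem_nhds hx)
  obtain ⟨y, hy⟩ := exists_ne x
  have hyd : 0 < dist y x := dist_pos.2 hy
  obtain ⟨r, hr, hrlt⟩ := exists_between (lt_min hr1 hyd)
  have hrr1 := hrlt.trans_le (min_le_left _ _)
  have hry := hrlt.trans_le (min_le_right _ _)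
  have hxB : x ∈ closedBall x r := mem_closedBall_self hr.le
  have hKc : IsSubcontinuum (connectedComponentIn (closedBall x r) x) :=
    ⟨by
      have : CompactSpace (closedBall x r) :=
        isCompact_iff_compactSpace.1 isClosed_closedBall.isCompact
      rw [connectedComponentIn_eq_image hxB]
      exact isClosed_connectedComponent.isCompact.image continuous_subtype_val,
    isConnected_connectedComponentIn_iff.2 hxB⟩
  refine ⟨connectedComponentIn (closedBall x r) x, hKc, bump x y r hr hry, ?_⟩
  have hsub := connectedComponentIn_subset (closedBall x r) x
  generalize connectedComponentIn (closedBall x r) x = K at hKc hsub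
  have : CompactSpace K := isCompact_iff_compactSpace.1 hKc.1
  have : ConnectedSpace K := isConnected_iff_connectedSpace.1 hKc.2
  intro ε hε
  obtain ⟨N, hN⟩ := small_fibers π hπ
    (fun n x y hxy => by rw [← hstep n x, ← hstep n y, hxy]) hinj (ε / 2) (by positivity)
  have hn := hN (φ N) (hφ.id_le N)
  obtain ⟨J, hJ, hAJ⟩ := tree_arc (hT (φ N)) (π (φ N) '' K)
    ⟨hKc.1.image (hπ _), hKc.2.image _ (hπ _).continuousOn⟩ (by
      rintro _ ⟨z, hz, rfl⟩ hbr
      have h1 : z ∈ P (φ N) := by rw [hP]; exact hbr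
      exact hball (closedBall_subset_ball hrr1 (hsub hz))
        (subset_closure (mem_iUnion.2 ⟨N, h1⟩)))
  obtain ⟨ψ, hψ, hψ'⟩ := arc_lift hJ (fun z : K => π (φ N) z.1)
    ((hπ _).comp continuous_subtype_val) (fun z => hAJ ⟨z.1, z.2, rfl⟩)
  exact chain_of_map ε hε ψ hψ (fun a b hab => hn a.1 b.1 (hψ' a b hab))
end
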